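/- Let T > 0 and let (u,p) be a smooth solution of the three-dimensional Navier–Stokes equations on [0,T) × ℝ³ with u(t,·) Schwartz for each t, and suppose ‖u(t)‖_{Ḣ^{3/2}} → ∞ as t → T⁻. Then there is a constant c > 0, independent of the solution, such that limsup_{t→T⁻} (T−t)·‖u(t)‖_{Ḣ^{5/2}} ≥ c. -/

import Mathlib

open MeasureTheory Filter SchwartzMap
open scoped FourierTransform

noncomputable section

abbrev Ell (n : ℕ) := EuclideanSpace ℝ (Fin n)

def eVec (n : ℕ) (i : Fin n) : Ell n := EuclideanSpace.single i 1

/-- coercion of a real-valued function to a complex-valued one -/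
def cf {n : ℕ} (f : Ell n → ℝ) : Ell n → ℂ := fun x => (f x : ℂ)

/-- the Fourier multiplier operator `Λ^s` with symbol `|ξ|^s` -/
def Lam {n : ℕ} (s : ℝ) (f : Ell n → ℂ) : Ell n → ℂ :=
  𝓕⁻ (fun ξ => ((‖ξ‖ ^ s : ℝ) : ℂ) * 𝓕 f ξ)

/-- the partial derivative `∂ᵢ` -/
def pd {n : ℕ} (i : Fin n) (f : Ell n → ℂ) : Ell n → ℂ :=
  fun x => fderiv ℝ f x (eVec n i)

/-- the advection term `(v·∇)w` for complex vector fields -/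
def adv {n : ℕ} (v w : Fin n → Ell n → ℂ) : Fin n → Ell n → ℂ :=
  fun l x => ∑ i, v i x * pd i (w l) x

/-- squared homogeneous Sobolev norm of a complex scalar function -/
def HsqC {n : ℕ} (s : ℝ) (f : Ell n → ℂ) : ℝ :=
  ∫ ξ, ‖ξ‖ ^ (2 * s) * ‖𝓕 f ξ‖ ^ 2

/-- homogeneous Sobolev norm `‖u‖_{Ḣ^s}` of a real vector field -/
def Hnorm {n : ℕ} (s : ℝ) (u : Fin n → Ell n → ℝ) : ℝ :=
  Real.sqrt (∑ l, HsqC s (cf (u l)))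

/-- `L²` norm of a complex vector field -/
def vL2 {n : ℕ} (f : Fin n → Ell n → ℂ) : ℝ :=
  Real.sqrt (∑ l, ∫ x, ‖f l x‖ ^ 2)

/-- `L²` pairing `⟨f,g⟩ = Σ_l ∫ f_l g_l` of complex vector fields -/
def Cinner {n : ℕ} (f g : Fin n → Ell n → ℂ) : ℂ :=
  ∑ l, ∫ x, f l x * g l x

/-- `(u, p)` is a smooth solution of the 3D Navier–Stokes equations on `[0,T) × ℝ³`
with `u(t,·)` Schwartz for each `t`: `u` and `p` are smooth on `[0,T) × ℝ³`, each
time-slice of `u` is a Schwartz vector field, `div u = 0`, and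
`∂ₜu − Δu + (u·∇)u + ∇p = 0` pointwise. -/
def IsNSSolution (T : ℝ) (u : ℝ → Ell 3 → Fin 3 → ℝ) (p : ℝ → Ell 3 → ℝ) : Prop :=
  (∀ l, ContDiffOn ℝ (⊤ : ℕ∞) (fun q : ℝ × Ell 3 => u q.1 q.2 l) (Set.Ico 0 T ×ˢ Set.univ)) ∧
  ContDiffOn ℝ (⊤ : ℕ∞) (fun q : ℝ × Ell 3 => p q.1 q.2) (Set.Ico 0 T ×ˢ Set.univ) ∧
  (∀ t ∈ Set.Ico (0 : ℝ) T, ∀ l, ∃ f : 𝓢(Ell 3, ℝ), ∀ x, u t x l = f x) ∧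
  (∀ t ∈ Set.Ico (0 : ℝ) T, ∀ x, ∑ i, fderiv ℝ (fun y => u t y i) x (eVec 3 i) = 0) ∧
  (∀ t ∈ Set.Ico (0 : ℝ) T, ∀ x, ∀ l, HasDerivWithinAt (fun s => u s x l)
    ((∑ i, fderiv ℝ (fun y => fderiv ℝ (fun z => u t z l) y (eVec 3 i)) x (eVec 3 i))
      - (∑ i, u t x i * fderiv ℝ (fun z => u t z l) x (eVec 3 i))
      - fderiv ℝ (fun z => p t z) x (eVec 3 l)) (Set.Ico 0 T) t)

open LineDeriv

/-- complex three-vectors -/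
abbrev CV := EuclideanSpace ℂ (Fin 3)

/-- the complex Schwartz vector field with prescribed real components -/
def asm : (Fin 3 → 𝓢(Ell 3, ℝ)) →ₗ[ℝ] 𝓢(Ell 3, CV) where
  toFun U := ∑ l, postcompCLM (Complex.ofRealCLM.smulRight (EuclideanSpace.single l (1:ℂ))) (U l)
  map_add' U W := by simp [Finset.sum_add_distrib]
  map_smul' c U := by simp [Finset.smul_sum]

theorem SchwartzMap.sum_apply' {ι F : Type*} [NormedAddCommGroup F] [NormedSpace ℝ F]
    (s : Finset ι) (f : ι → 𝓢(Ell 3, F)) (x : Ell 3) : (∑ i ∈ s, f i) x = ∑ i ∈ s, f i x := by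
  classical
  induction s using Finset.induction_on with
  | empty => simp
  | insert a s ha ih => rw [Finset.sum_insert ha, Finset.sum_insert ha, add_apply, ih]

theorem asm_apply (U : Fin 3 → 𝓢(Ell 3, ℝ)) (x : Ell 3) (l : Fin 3) :
    asm U x l = (U l x : ℂ) := by
  change (∑ i, postcompCLM (Complex.ofRealCLM.smulRight (EuclideanSpace.single i (1:ℂ)))
    (U i)) x l = _
  rw [SchwartzMap.sum_apply']
  simp [Finset.sum_apply, Pi.single_apply]

theorem norm_asm_sq (U : Fin 3 → 𝓢(Ell 3, ℝ)) (x : Ell 3) :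
    ‖asm U x‖ ^ 2 = ∑ l, (U l x) ^ 2 := by
  rw [EuclideanSpace.norm_sq_eq]
  simp [asm_apply]

theorem asm_lineDerivOp (U : Fin 3 → 𝓢(Ell 3, ℝ)) (m : Ell 3) :
    asm (fun l => ∂_{m} (U l)) = ∂_{m} (asm U) := by
  ext x l
  rw [asm_apply]
  rw [SchwartzMap.lineDerivOp_apply_eq_fderiv, SchwartzMap.lineDerivOp_apply_eq_fderiv]
  have h1 : HasFDerivAt (fun y => asm U y l)
    (((EuclideanSpace.proj l : CV →L[ℂ] ℂ).restrictScalars ℝ).comp (fderiv ℝ (asm U) x)) x :=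
    ((EuclideanSpace.proj l : CV →L[ℂ] ℂ).restrictScalars ℝ).hasFDerivAt.comp x
      ((asm U).differentiableAt.hasFDerivAt)
  have h2 : HasFDerivAt (fun y => asm U y l) (Complex.ofRealCLM.comp (fderiv ℝ (U l) x)) x := by
    have := Complex.ofRealCLM.hasFDerivAt.comp x ((U l).differentiableAt (x := x)).hasFDerivAt
    refine this.congr_of_eventuallyEq (Eventually.of_forall fun y => ?_)
    simp [asm_apply]
  have := congrArg (fun L => L m) (h1.unique h2)
  simpa using this.symm

theorem fourier_asm_apply (U : Fin 3 → 𝓢(Ell 3, ℝ)) (ξ : Ell 3) (l : Fin 3) :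
    𝓕 (asm U) ξ l = 𝓕 (cf (U l)) ξ := by
  have h : (⇑(EuclideanSpace.proj l : CV →L[ℂ] ℂ) ∘ ⇑(asm U)) = cf (U l) := by
    ext x; simp [asm_apply, cf]
  rw [SchwartzMap.fourier_coe, ← h]
  rw [Real.fourier_eq, Real.fourier_eq]
  have := (EuclideanSpace.proj l : CV →L[ℂ] ℂ).integral_comp_comm
    (φ := fun v => 𝐞 (-inner ℝ v ξ) • asm U v)
    ((Real.fourierIntegral_convergent_iff ξ).2 ((asm U).integrable (μ := volume)))
  refine this.symm.trans ?_
  simp [Circle.smul_def]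

theorem fourier_lineDerivOp_apply (f : 𝓢(Ell 3, CV)) (i : Fin 3) (ξ : Ell 3) :
    𝓕 (∂_{eVec 3 i} f) ξ = (2 * Real.pi * Complex.I * ξ i) • 𝓕 f ξ := by
  rw [SchwartzMap.fourier_lineDerivOp_eq, smul_apply,
    smulLeftCLM_apply_apply (by fun_prop)]
  simp only [eVec, EuclideanSpace.inner_single_right]
  simp [mul_smul]

section CauchySchwarz
variable {α : Type*} [MeasurableSpace α] {μ : Measure α}

theorem integral_mul_sq_le {f g : α → ℝ} (hf : Integrable (fun x => f x ^ 2) μ)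
    (hg : Integrable (fun x => g x ^ 2) μ) (hfg : Integrable (fun x => f x * g x) μ) :
    (∫ x, f x * g x ∂μ) ^ 2 ≤ (∫ x, f x ^ 2 ∂μ) * ∫ x, g x ^ 2 ∂μ := by
  have h : ∀ r : ℝ, 0 ≤ (∫ x, g x ^ 2 ∂μ) * (r * r) + (-2 * ∫ x, f x * g x ∂μ) * r
      + ∫ x, f x ^ 2 ∂μ := by
    intro r
    have : (∫ x, g x ^ 2 ∂μ) * (r * r) + (-2 * ∫ x, f x * g x ∂μ) * r + ∫ x, f x ^ 2 ∂μ
        = ∫ x, (f x - r * g x) ^ 2 ∂μ := by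
      have e : ∀ x, (f x - r * g x) ^ 2 = r ^ 2 * g x ^ 2 + (-2 * r) * (f x * g x) + f x ^ 2 := by
        intro x; ring
      simp only [e]
      have i : Integrable (fun x => r ^ 2 * g x ^ 2 + (-2 * r) * (f x * g x)) μ :=
        (hg.const_mul _).add (hfg.const_mul _)
      rw [integral_add i hf,
        integral_add (hg.const_mul _) (hfg.const_mul _), integral_const_mul, integral_const_mul]
      ring
    rw [this]
    exact integral_nonneg fun x => sq_nonneg _
  have := discrim_le_zero h
  rw [discrim] at this
  nlinarith
end CauchySchwarz

/-- the integral of `|ξ|^k |f̂|²` -/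
def J (k : ℕ) (f : 𝓢(Ell 3, CV)) : ℝ := ∫ ξ, ‖ξ‖ ^ k * ‖𝓕 f ξ‖ ^ 2

/-- the pairing of `a` and `b` with Fourier weight `m(ξ)|ξ|²` -/
def Pm (m : Ell 3 → ℝ) (a b : 𝓢(Ell 3, CV)) : ℝ :=
  ∫ ξ, m ξ * ‖ξ‖ ^ 2 * (inner ℂ (𝓕 a ξ) (𝓕 b ξ)).re

theorem integrable_pow_mul_norm_mul_norm (k : ℕ) (f g : 𝓢(Ell 3, CV)) :
    Integrable (fun ξ => ‖ξ‖ ^ k * (‖f ξ‖ * ‖g ξ‖)) := by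
  obtain ⟨C, hC⟩ := g.decay 0 0
  refine ((f.integrable_pow_mul volume k).mul_const C).mono' ?_ (Eventually.of_forall fun ξ => ?_)
  · exact ((continuous_norm.pow k).mul
      (f.continuous.norm.mul g.continuous.norm)).aestronglyMeasurable
  · have h := hC.2 ξ
    simp only [pow_zero, norm_iteratedFDeriv_zero, one_mul] at h
    rw [Real.norm_of_nonneg (by positivity), ← mul_assoc]
    gcongr

theorem integrable_pow_mul_norm_sq (k : ℕ) (f : 𝓢(Ell 3, CV)) :
    Integrable (fun ξ => ‖ξ‖ ^ k * ‖f ξ‖ ^ 2) := by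
  simpa [pow_two] using integrable_pow_mul_norm_mul_norm k f f

theorem J_nonneg (k : ℕ) (f : 𝓢(Ell 3, CV)) : 0 ≤ J k f :=
  integral_nonneg fun _ => by positivity

theorem abs_re_inner_le (a b : CV) : |(inner ℂ a b).re| ≤ ‖a‖ * ‖b‖ :=
  (Complex.abs_re_le_norm _).trans (norm_inner_le_norm a b)

theorem integrable_weight_inner {m : Ell 3 → ℝ} (hm : Continuous m) {M : ℝ}
    (hM : ∀ ξ, |m ξ| ≤ M) (k : ℕ) (f g : 𝓢(Ell 3, CV)) :
    Integrable (fun ξ => m ξ * ‖ξ‖ ^ k * (inner ℂ (f ξ) (g ξ)).re) := by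
  refine ((integrable_pow_mul_norm_mul_norm k f g).const_mul M).mono' ?_
    (Eventually.of_forall fun ξ => ?_)
  · exact ((hm.mul (continuous_norm.pow k)).mul (Complex.continuous_re.comp
      (f.continuous.inner g.continuous))).aestronglyMeasurable
  · rw [norm_mul, norm_mul, Real.norm_eq_abs, Real.norm_eq_abs, Real.norm_eq_abs,
      abs_of_nonneg (pow_nonneg (norm_nonneg ξ) k), mul_assoc]
    have := abs_re_inner_le (f ξ) (g ξ)
    have h0 : 0 ≤ M := (abs_nonneg _).trans (hM ξ)
    gcongr
    exact hM ξ

theorem J_interp (k : ℕ) (f : 𝓢(Ell 3, CV)) : J (k + 1) f ^ 2 ≤ J k f * J (k + 2) f := by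
  have h : ∀ r : ℝ, 0 ≤ J (k + 2) f * (r * r) + (-2 * J (k + 1) f) * r + J k f := by
    intro r
    have i0 := integrable_pow_mul_norm_sq k (𝓕 f)
    have i1 := integrable_pow_mul_norm_sq (k + 1) (𝓕 f)
    have i2 := integrable_pow_mul_norm_sq (k + 2) (𝓕 f)
    have : J (k + 2) f * (r * r) + (-2 * J (k + 1) f) * r + J k f
        = ∫ ξ, ‖ξ‖ ^ k * ((1 - r * ‖ξ‖) ^ 2 * ‖𝓕 f ξ‖ ^ 2) := by
      have e : ∀ ξ : Ell 3, ‖ξ‖ ^ k * ((1 - r * ‖ξ‖) ^ 2 * ‖𝓕 f ξ‖ ^ 2)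
          = r ^ 2 * (‖ξ‖ ^ (k + 2) * ‖𝓕 f ξ‖ ^ 2) + (-2 * r) * (‖ξ‖ ^ (k + 1) * ‖𝓕 f ξ‖ ^ 2)
            + ‖ξ‖ ^ k * ‖𝓕 f ξ‖ ^ 2 := by
        intro ξ; ring
      simp only [e]
      have i : Integrable (fun ξ : Ell 3 => r ^ 2 * (‖ξ‖ ^ (k + 2) * ‖𝓕 f ξ‖ ^ 2)
          + (-2 * r) * (‖ξ‖ ^ (k + 1) * ‖𝓕 f ξ‖ ^ 2)) :=
        (i2.const_mul _).add (i1.const_mul _)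
      rw [integral_add i i0,
        integral_add (i2.const_mul _) (i1.const_mul _), integral_const_mul, integral_const_mul]
      simp only [J]
      ring
    rw [this]
    exact integral_nonneg fun x => by positivity
  have := discrim_le_zero h
  rw [discrim] at this
  nlinarith

theorem J_four_pow_three_le (f : 𝓢(Ell 3, CV)) : J 4 f ^ 3 ≤ J 2 f * J 5 f ^ 2 := by
  have h1 := J_interp 2 f
  have h2 := J_interp 3 f
  norm_num at h1 h2
  have a2 := J_nonneg 2 f
  have a3 := J_nonneg 3 f
  have a4 := J_nonneg 4 f
  have a5 := J_nonneg 5 f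
  rcases eq_or_lt_of_le a4 with h | h
  · rw [← h]; simp; positivity
  · have h3 : (J 4 f ^ 2) ^ 2 ≤ (J 3 f * J 5 f) ^ 2 := by gcongr
    have h4 : J 4 f * J 4 f ^ 3 ≤ J 4 f * (J 2 f * J 5 f ^ 2) := by
      calc _ = (J 4 f ^ 2) ^ 2 := by ring
        _ ≤ _ := h3
        _ = J 3 f ^ 2 * J 5 f ^ 2 := by ring
        _ ≤ (J 2 f * J 4 f) * J 5 f ^ 2 := by gcongr
        _ = _ := by ring
    exact le_of_mul_le_mul_left h4 h

theorem fourier_add_apply (f g : 𝓢(Ell 3, CV)) (ξ : Ell 3) : 𝓕 (f + g) ξ = 𝓕 f ξ + 𝓕 g ξ := by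
  rw [FourierTransform.fourier_add, add_apply]

theorem fourier_sub_apply (f g : 𝓢(Ell 3, CV)) (ξ : Ell 3) : 𝓕 (f - g) ξ = 𝓕 f ξ - 𝓕 g ξ := by
  have : 𝓕 (f - g) = 𝓕 f - 𝓕 g := map_sub (FourierTransform.fourierCLM ℂ 𝓢(Ell 3, CV)) f g
  rw [this, sub_apply]

theorem J_add_le (k : ℕ) (f g : 𝓢(Ell 3, CV)) : J k (f + g) ≤ 2 * J k f + 2 * J k g := by
  simp only [J]
  rw [← integral_const_mul, ← integral_const_mul, ← integral_add
    ((integrable_pow_mul_norm_sq k _).const_mul 2) ((integrable_pow_mul_norm_sq k _).const_mul 2)]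
  refine integral_mono (integrable_pow_mul_norm_sq k _)
    (((integrable_pow_mul_norm_sq k _).const_mul 2).add
      ((integrable_pow_mul_norm_sq k _).const_mul 2)) fun ξ => ?_
  have h : ‖𝓕 (f + g) ξ‖ ^ 2 ≤ 2 * ‖𝓕 f ξ‖ ^ 2 + 2 * ‖𝓕 g ξ‖ ^ 2 := by
    rw [fourier_add_apply]
    have := norm_add_le (𝓕 f ξ) (𝓕 g ξ)
    have := norm_nonneg (𝓕 f ξ + 𝓕 g ξ)
    nlinarith [sq_nonneg (‖𝓕 f ξ‖ - ‖𝓕 g ξ‖)]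
  have := mul_le_mul_of_nonneg_left h (pow_nonneg (norm_nonneg ξ) k)
  simp only
  linarith

theorem J_neg (k : ℕ) (f : 𝓢(Ell 3, CV)) : J k (-f) = J k f := by
  have : 𝓕 (-f) = - 𝓕 f := map_neg (FourierTransform.fourierCLM ℂ 𝓢(Ell 3, CV)) f
  simp only [J, this, neg_apply, norm_neg]

theorem J_sub_comm (k : ℕ) (f g : 𝓢(Ell 3, CV)) : J k (f - g) = J k (g - f) := by
  rw [← J_neg, neg_sub]

theorem J_sub_le (k : ℕ) (f g : 𝓢(Ell 3, CV)) : J k (f - g) ≤ 2 * J k f + 2 * J k g := by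
  rw [sub_eq_add_neg, ← J_neg k g]
  exact J_add_le k f (-g)

theorem J_le_add_sub (k : ℕ) (f g : 𝓢(Ell 3, CV)) : J k f ≤ 2 * J k g + 2 * J k (f - g) := by
  simpa using J_add_le k g (f - g)

section Pairing
variable {m : Ell 3 → ℝ} {M : ℝ}

theorem Pm_add_right (hm : Continuous m) (hM : ∀ ξ, |m ξ| ≤ M) (a b c : 𝓢(Ell 3, CV)) :
    Pm m a (b + c) = Pm m a b + Pm m a c := by
  simp only [Pm]
  rw [← integral_add (integrable_weight_inner hm hM 2 _ _) (integrable_weight_inner hm hM 2 _ _)]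
  refine integral_congr_ae (Eventually.of_forall fun ξ => ?_)
  simp only [fourier_add_apply, inner_add_right, Complex.add_re]
  ring

theorem Pm_sub_add (hm : Continuous m) (hM : ∀ ξ, |m ξ| ≤ M) (a b : 𝓢(Ell 3, CV)) :
    Pm m (a - b) (a + b) = Pm m a a - Pm m b b := by
  simp only [Pm]
  rw [← integral_sub (integrable_weight_inner hm hM 2 _ _) (integrable_weight_inner hm hM 2 _ _)]
  refine integral_congr_ae (Eventually.of_forall fun ξ => ?_)
  simp only [fourier_add_apply, fourier_sub_apply, inner_add_right, inner_sub_left, Complex.add_re,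
    Complex.sub_re]
  have h : (inner ℂ (𝓕 a ξ) (𝓕 b ξ)).re = (inner ℂ (𝓕 b ξ) (𝓕 a ξ)).re := by
    rw [← inner_conj_symm, Complex.conj_re]
  rw [h]
  ring

theorem re_inner_self (a : CV) : (inner ℂ a a).re = ‖a‖ ^ 2 := by
  rw [inner_self_eq_norm_sq_to_K]
  norm_cast

theorem Pm_self (m : Ell 3 → ℝ) (a : 𝓢(Ell 3, CV)) :
    Pm m a a = ∫ ξ, m ξ * ‖ξ‖ ^ 2 * ‖𝓕 a ξ‖ ^ 2 := by
  simp only [Pm, re_inner_self]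

theorem Pm_one_self (a : 𝓢(Ell 3, CV)) : Pm (fun _ => 1) a a = J 2 a := by
  rw [Pm_self]
  simp [J]

theorem integral_norm_mul_norm_sq_le (i j : ℕ) (a b : 𝓢(Ell 3, CV)) :
    (∫ ξ, ‖ξ‖ ^ (i + j) * (‖𝓕 a ξ‖ * ‖𝓕 b ξ‖)) ^ 2 ≤ J (2 * i) a * J (2 * j) b := by
  have := integral_mul_sq_le (μ := volume) (f := fun ξ : Ell 3 => ‖ξ‖ ^ i * ‖𝓕 a ξ‖)
    (g := fun ξ => ‖ξ‖ ^ j * ‖𝓕 b ξ‖) ?_ ?_ ?_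
  · have e1 : ∀ ξ : Ell 3, (‖ξ‖ ^ i * ‖𝓕 a ξ‖) ^ 2 = ‖ξ‖ ^ (2 * i) * ‖𝓕 a ξ‖ ^ 2 := by
      intro ξ; ring
    have e2 : ∀ ξ : Ell 3, (‖ξ‖ ^ j * ‖𝓕 b ξ‖) ^ 2 = ‖ξ‖ ^ (2 * j) * ‖𝓕 b ξ‖ ^ 2 := by
      intro ξ; ring
    have e3 : ∀ ξ : Ell 3, (‖ξ‖ ^ i * ‖𝓕 a ξ‖) * (‖ξ‖ ^ j * ‖𝓕 b ξ‖)
        = ‖ξ‖ ^ (i + j) * (‖𝓕 a ξ‖ * ‖𝓕 b ξ‖) := by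
      intro ξ; ring
    simp only [e1, e2, e3] at this
    exact this
  · refine (integrable_pow_mul_norm_sq (2 * i) (𝓕 a)).congr (Eventually.of_forall fun ξ => ?_)
    simp only; ring
  · refine (integrable_pow_mul_norm_sq (2 * j) (𝓕 b)).congr (Eventually.of_forall fun ξ => ?_)
    simp only; ring
  · refine (integrable_pow_mul_norm_mul_norm (i + j) (𝓕 a) (𝓕 b)).congr
      (Eventually.of_forall fun ξ => ?_)
    simp only; ring

theorem abs_Pm_le (hm : Continuous m) (hM : ∀ ξ, |m ξ| ≤ M) (a b : 𝓢(Ell 3, CV)) :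
    |Pm m a b| ≤ M * √(J 0 a * J 4 b) := by
  have h0 : 0 ≤ M := (abs_nonneg _).trans (hM 0)
  have h1 : |Pm m a b| ≤ M * ∫ ξ, ‖ξ‖ ^ (0 + 2) * (‖𝓕 a ξ‖ * ‖𝓕 b ξ‖) := by
    rw [Pm, ← integral_const_mul]
    refine abs_integral_le_integral_abs.trans (integral_mono
      (integrable_weight_inner hm hM 2 _ _).abs
      ((integrable_pow_mul_norm_mul_norm (0 + 2) _ _).const_mul M) fun ξ => ?_)
    simp only [abs_mul, abs_pow, abs_norm, zero_add, mul_assoc]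
    have := abs_re_inner_le (𝓕 a ξ) (𝓕 b ξ)
    gcongr
    exact hM ξ
  refine h1.trans (mul_le_mul_of_nonneg_left ?_ h0)
  exact Real.le_sqrt_of_sq_le (integral_norm_mul_norm_sq_le 0 2 a b)

theorem J_sub_sq_le (j : ℕ) (a b : 𝓢(Ell 3, CV)) :
    (J (2 * j) a - J (2 * j) b) ^ 2 ≤ J (2 * j) (a - b) * J (2 * j) (a + b) := by
  refine le_trans ?_ (integral_norm_mul_norm_sq_le j j (a - b) (a + b))
  rw [← sq_abs]
  gcongr
  simp only [J]
  rw [← integral_sub (integrable_pow_mul_norm_sq _ _) (integrable_pow_mul_norm_sq _ _)]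
  refine abs_integral_le_integral_abs.trans (integral_mono
    ((integrable_pow_mul_norm_sq _ _).sub (integrable_pow_mul_norm_sq _ _)).abs
    (integrable_pow_mul_norm_mul_norm _ _ _) fun ξ => ?_)
  simp only [← two_mul, fourier_add_apply, fourier_sub_apply]
  rw [← mul_sub, abs_mul, abs_of_nonneg (pow_nonneg (norm_nonneg ξ) _)]
  gcongr
  have h : ‖𝓕 a ξ‖ ^ 2 - ‖𝓕 b ξ‖ ^ 2 = (inner ℂ (𝓕 a ξ - 𝓕 b ξ) (𝓕 a ξ + 𝓕 b ξ)).re := by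
    simp only [inner_add_right, inner_sub_left, Complex.add_re, Complex.sub_re, re_inner_self]
    have h : (inner ℂ (𝓕 a ξ) (𝓕 b ξ)).re = (inner ℂ (𝓕 b ξ) (𝓕 a ξ)).re := by
      rw [← inner_conj_symm, Complex.conj_re]
    rw [h]; ring
  rw [h]
  exact abs_re_inner_le _ _

end Pairing

section Plancherel

theorem J_zero_asm (U : Fin 3 → 𝓢(Ell 3, ℝ)) : J 0 (asm U) = ∫ x, ∑ l, (U l x) ^ 2 := by
  simp only [J, pow_zero, one_mul]
  rw [SchwartzMap.integral_norm_sq_fourier]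
  simp only [norm_asm_sq]

theorem sum_J_lineDerivOp (k : ℕ) (f : 𝓢(Ell 3, CV)) :
    ∑ i, J k (∂_{eVec 3 i} f) = (2 * Real.pi) ^ 2 * J (k + 2) f := by
  simp only [J]
  rw [← integral_finsetSum _ fun i _ => integrable_pow_mul_norm_sq _ _, ← integral_const_mul]
  refine integral_congr_ae (Eventually.of_forall fun ξ => ?_)
  simp only [fourier_lineDerivOp_apply, norm_smul, mul_pow, norm_mul, Complex.norm_real,
    Complex.norm_I, ← Finset.mul_sum, ← Finset.sum_mul, Real.norm_eq_abs, sq_abs,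
    Complex.norm_ofNat,
    mul_one]
  have h : ‖ξ‖ ^ 2 = ∑ i, ξ i ^ 2 := by simp [EuclideanSpace.norm_sq_eq]
  rw [pow_add, h]
  ring

/-- the product of two real Schwartz functions -/
def mulS (f g : 𝓢(Ell 3, ℝ)) : 𝓢(Ell 3, ℝ) := pairing (ContinuousLinearMap.mul ℝ ℝ) f g

theorem mulS_apply (f g : 𝓢(Ell 3, ℝ)) (x : Ell 3) : mulS f g x = f x * g x := by
  simp [mulS, pairing_apply_apply]

theorem integrable_mul (f g : 𝓢(Ell 3, ℝ)) : Integrable (fun x => f x * g x) := by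
  exact ((mulS f g).integrable (μ := volume)).congr (Eventually.of_forall (mulS_apply f g))

theorem sum_integral_lineDerivOp_sq (U : Fin 3 → 𝓢(Ell 3, ℝ)) :
    ∑ i, ∫ x, ∑ l, (∂_{eVec 3 i} (U l) x) ^ 2 = (2 * Real.pi) ^ 2 * J 2 (asm U) := by
  rw [← sum_J_lineDerivOp 0]
  simp only [← asm_lineDerivOp, J_zero_asm]

theorem sum_integral_lineDerivOp_lineDerivOp_sq (U : Fin 3 → 𝓢(Ell 3, ℝ)) :
    ∑ j, ∑ i, ∫ x, ∑ l, (∂_{eVec 3 j} (∂_{eVec 3 i} (U l)) x) ^ 2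
      = (2 * Real.pi) ^ 4 * J 4 (asm U) := by
  have h := fun j => sum_integral_lineDerivOp_sq (fun l => ∂_{eVec 3 j} (U l))
  have e : ((2 * Real.pi) ^ 4 : ℝ) = (2 * Real.pi) ^ 2 * (2 * Real.pi) ^ 2 := by ring
  rw [Finset.sum_comm]
  simp only [h, asm_lineDerivOp]
  rw [← Finset.mul_sum, sum_J_lineDerivOp, ← mul_assoc, ← e]

end Plancherel

section Agmon

theorem integrable_inv_norm_sq_mul :
    Integrable (fun ξ : Ell 3 => (‖ξ‖ ^ 2 * (1 + ‖ξ‖ ^ 2))⁻¹) := by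
  have h := (integrable_fun_norm_addHaar (E := Ell 3) volume
    (f := fun y : ℝ => (y ^ 2 * (1 + y ^ 2))⁻¹)).2
  refine h ?_
  refine (integrable_inv_one_add_sq.integrableOn (s := Set.Ioi (0:ℝ))).congr_fun ?_
    measurableSet_Ioi
  intro y hy
  have hy : (0:ℝ) < y := hy
  simp only [finrank_euclideanSpace, Fintype.card_fin, smul_eq_mul]
  field_simp

theorem integral_inv_norm_sq_mul_scale {r : ℝ} (hr : 0 < r) :
    Integrable (fun ξ : Ell 3 => (‖ξ‖ ^ 2 * (1 + r ^ 2 * ‖ξ‖ ^ 2))⁻¹) ∧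
    ∫ ξ : Ell 3, (‖ξ‖ ^ 2 * (1 + r ^ 2 * ‖ξ‖ ^ 2))⁻¹
      = r⁻¹ * ∫ ξ : Ell 3, (‖ξ‖ ^ 2 * (1 + ‖ξ‖ ^ 2))⁻¹ := by
  have e : ∀ ξ : Ell 3, (‖ξ‖ ^ 2 * (1 + r ^ 2 * ‖ξ‖ ^ 2))⁻¹
      = r ^ 2 * (‖r • ξ‖ ^ 2 * (1 + ‖r • ξ‖ ^ 2))⁻¹ := by
    intro ξ
    rw [norm_smul, Real.norm_of_nonneg hr.le]
    rcases eq_or_ne ξ 0 with rfl | h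
    · simp
    · have := norm_pos_iff.2 h
      field_simp
  simp only [e]
  refine ⟨(integrable_inv_norm_sq_mul.comp_smul hr.ne').const_mul _, ?_⟩
  rw [integral_const_mul, Measure.integral_comp_smul volume
    (fun ξ : Ell 3 => (‖ξ‖ ^ 2 * (1 + ‖ξ‖ ^ 2))⁻¹)]
  simp only [finrank_euclideanSpace, Fintype.card_fin, smul_eq_mul, abs_inv, abs_pow,
    abs_of_pos hr]
  field_simp

theorem norm_le_integral_norm_fourier (f : 𝓢(Ell 3, CV)) (x : Ell 3) :
    ‖f x‖ ≤ ∫ ξ, ‖𝓕 f ξ‖ := by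
  have h : f = 𝓕⁻ (𝓕 f) := by simp
  conv_lhs => rw [h]
  rw [SchwartzMap.fourierInv_coe, Real.fourierInv_eq]
  refine (norm_integral_le_integral_norm _).trans (le_of_eq ?_)
  simp

theorem agmon : ∃ C > (0:ℝ), ∀ (f : 𝓢(Ell 3, CV)) (x : Ell 3), ‖f x‖ ^ 4 ≤ C * (J 2 f * J 4 f) := by
  set c : ℝ := ∫ ξ : Ell 3, (‖ξ‖ ^ 2 * (1 + ‖ξ‖ ^ 2))⁻¹ with hc
  have c0 : 0 ≤ c := integral_nonneg fun _ => by positivity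
  refine ⟨4 * c ^ 2 + 1, by positivity, fun f x => ?_⟩
  set I : ℝ := ∫ ξ, ‖𝓕 f ξ‖ with hI
  have I0 : 0 ≤ I := integral_nonneg fun _ => by positivity
  have J2 := J_nonneg 2 f
  have J4 := J_nonneg 4 f
  have key : ∀ r : ℝ, 0 < r → I ^ 2 ≤ (J 2 f + r ^ 2 * J 4 f) * (r⁻¹ * c) := by
    intro r hr
    obtain ⟨hi, he⟩ := integral_inv_norm_sq_mul_scale hr
    have hw : ∀ ξ : Ell 3, √(‖ξ‖ ^ 2 * (1 + r ^ 2 * ‖ξ‖ ^ 2)) ^ 2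
        = ‖ξ‖ ^ 2 * (1 + r ^ 2 * ‖ξ‖ ^ 2) := fun ξ => Real.sq_sqrt (by positivity)
    have e1 : ∀ ξ : Ell 3, (√(‖ξ‖ ^ 2 * (1 + r ^ 2 * ‖ξ‖ ^ 2)) * ‖𝓕 f ξ‖) ^ 2
        = ‖ξ‖ ^ 2 * ‖𝓕 f ξ‖ ^ 2 + r ^ 2 * (‖ξ‖ ^ 4 * ‖𝓕 f ξ‖ ^ 2) := by
      intro ξ; rw [mul_pow, hw]; ring
    have e3 : ∀ᵐ ξ : Ell 3, ‖𝓕 f ξ‖ = (√(‖ξ‖ ^ 2 * (1 + r ^ 2 * ‖ξ‖ ^ 2)) * ‖𝓕 f ξ‖)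
        * (√(‖ξ‖ ^ 2 * (1 + r ^ 2 * ‖ξ‖ ^ 2)))⁻¹ := by
      have : ∀ᵐ ξ : Ell 3, ξ ≠ 0 := by
        rw [ae_iff]; simp
      filter_upwards [this] with ξ h
      have h := norm_pos_iff.2 h
      have : 0 < √(‖ξ‖ ^ 2 * (1 + r ^ 2 * ‖ξ‖ ^ 2)) := Real.sqrt_pos.2 (by positivity)
      field_simp
    have i2 := integrable_pow_mul_norm_sq 2 (𝓕 f)
    have i4 := integrable_pow_mul_norm_sq 4 (𝓕 f)
    have := integral_mul_sq_le (μ := volume)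
      (f := fun ξ : Ell 3 => √(‖ξ‖ ^ 2 * (1 + r ^ 2 * ‖ξ‖ ^ 2)) * ‖𝓕 f ξ‖)
      (g := fun ξ : Ell 3 => (√(‖ξ‖ ^ 2 * (1 + r ^ 2 * ‖ξ‖ ^ 2)))⁻¹)
      (by simp only [e1]; exact i2.add (i4.const_mul _))
      (by simp only [inv_pow, hw]; exact hi)
      (((𝓕 f).integrable (μ := volume)).norm.congr e3)
    rw [← integral_congr_ae e3] at this
    simp only [e1, inv_pow, hw] at this
    rw [integral_add i2 (i4.const_mul _), integral_const_mul, he] at this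
    exact this
  have quad : ∀ r : ℝ, 0 ≤ (c * J 4 f) * (r * r) + (- I ^ 2) * r + c * J 2 f := by
    intro r
    rcases le_or_gt r 0 with h | h
    · have h1 : 0 ≤ (c * J 4 f) * (r * r) := mul_nonneg (by positivity) (mul_self_nonneg r)
      have h2 : 0 ≤ c * J 2 f := by positivity
      have h3 : 0 ≤ (- I ^ 2) * r := by nlinarith [sq_nonneg I]
      linarith
    · have h1 := mul_le_mul_of_nonneg_right (key r h) h.le
      have h2 : (J 2 f + r ^ 2 * J 4 f) * (r⁻¹ * c) * r = (J 2 f + r ^ 2 * J 4 f) * c := by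
        field_simp
      nlinarith
  have hd := discrim_le_zero quad
  rw [discrim] at hd
  have hx : ‖f x‖ ^ 4 ≤ I ^ 4 := by
    gcongr
    exact norm_le_integral_norm_fourier f x
  have : 0 ≤ J 2 f * J 4 f := by positivity
  nlinarith

end Agmon

section Nonlinear

/-- the advection term `(U·∇)U` -/
def advS (U : Fin 3 → 𝓢(Ell 3, ℝ)) : Fin 3 → 𝓢(Ell 3, ℝ) :=
  fun l => ∑ i, mulS (U i) (∂_{eVec 3 i} (U l))

/-- the right-hand side `ΔU − (U·∇)U` of the equation without the pressure -/
def rhsS (U : Fin 3 → 𝓢(Ell 3, ℝ)) : Fin 3 → 𝓢(Ell 3, ℝ) :=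
  fun l => ∑ i, ∂_{eVec 3 i} (∂_{eVec 3 i} (U l)) - advS U l

theorem lineDerivOp_mulS (f g : 𝓢(Ell 3, ℝ)) (v x : Ell 3) :
    ∂_{v} (mulS f g) x = ∂_{v} f x * g x + f x * ∂_{v} g x := by
  simp only [SchwartzMap.lineDerivOp_apply_eq_fderiv]
  have h : ⇑(mulS f g) = fun y => f y * g y := by ext y; exact mulS_apply f g y
  rw [h, fderiv_fun_mul f.differentiableAt g.differentiableAt]
  simp
  ring

theorem integrable_sq (f : 𝓢(Ell 3, ℝ)) : Integrable (fun x => f x ^ 2) := by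
  simpa only [pow_two] using integrable_mul f f

theorem integrable_pow_four (f : 𝓢(Ell 3, ℝ)) : Integrable (fun x => f x ^ 4) := by
  refine (integrable_sq (mulS f f)).congr (Eventually.of_forall fun x => ?_)
  simp only [mulS_apply]; ring

theorem integral_lineDerivOp_pow_four_le (f : 𝓢(Ell 3, ℝ)) {S : ℝ} (hS : ∀ x, |f x| ≤ S)
    (v : Ell 3) : ∫ x, (∂_{v} f x) ^ 4 ≤ 9 * S ^ 2 * ∫ x, (∂_{v} (∂_{v} f) x) ^ 2 := by
  set g := ∂_{v} f with hg
  have h := integral_mul_lineDerivOp_right_eq_neg_left (μ := volume) (mulS g (mulS g g)) f v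
  have e1 : ∀ x, mulS g (mulS g g) x * ∂_{v} f x = g x ^ 4 := by
    intro x; simp only [mulS_apply]; rw [← hg]; ring
  have e2 : ∀ x, ∂_{v} (mulS g (mulS g g)) x * f x = 3 * g x ^ 2 * ∂_{v} g x * f x := by
    intro x; simp only [lineDerivOp_mulS, mulS_apply]; ring
  have i2 : Integrable (fun x => ∂_{v} (mulS g (mulS g g)) x * f x) := integrable_mul _ _
  simp only [e1] at h
  have i4 := integrable_pow_four g
  have iB := integrable_sq (∂_{v} g)
  have h2 : ∫ x, g x ^ 4 ≤ ∫ x, ((1/2) * g x ^ 4 + (9 * S ^ 2 / 2) * (∂_{v} g x) ^ 2) := by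
    rw [h, ← integral_neg]
    refine integral_mono i2.neg ((i4.const_mul _).add (iB.const_mul _)) fun x => ?_
    simp only [e2]
    have hx := hS x
    have hs : f x ^ 2 ≤ S ^ 2 :=
      sq_le_sq' (by linarith [neg_abs_le (f x)]) ((le_abs_self _).trans hx)
    have h3 := mul_le_mul_of_nonneg_right hs (sq_nonneg (∂_{v} g x))
    nlinarith [sq_nonneg (g x ^ 2 + 3 * (∂_{v} g x * f x))]
  rw [integral_add (i4.const_mul _) (iB.const_mul _), integral_const_mul, integral_const_mul] at h2
  linarith

theorem advS_apply (U : Fin 3 → 𝓢(Ell 3, ℝ)) (l : Fin 3) (x : Ell 3) :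
    advS U l x = ∑ i, U i x * ∂_{eVec 3 i} (U l) x := by
  simp only [advS, SchwartzMap.sum_apply', mulS_apply]

theorem J_zero_advS_le (U : Fin 3 → 𝓢(Ell 3, ℝ)) {S : ℝ} (hS : ∀ l x, |U l x| ≤ S) :
    J 0 (asm (advS U)) ≤ 3 * (2 * Real.pi) ^ 2 * S ^ 2 * J 2 (asm U) := by
  have h := sum_integral_lineDerivOp_sq U
  have e : 3 * (2 * Real.pi) ^ 2 * S ^ 2 * J 2 (asm U)
      = 3 * S ^ 2 * ∑ i, ∫ x, ∑ l, (∂_{eVec 3 i} (U l) x) ^ 2 := by rw [h]; ring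
  have i1 : ∀ i, Integrable (fun x => ∑ l, (∂_{eVec 3 i} (U l) x) ^ 2) := fun i =>
    integrable_finsetSum _ fun l _ => integrable_sq _
  rw [e, J_zero_asm, ← integral_finsetSum _ fun i _ => i1 i, ← integral_const_mul]
  refine integral_mono (integrable_finsetSum _ fun l _ => integrable_sq _)
    ((integrable_finsetSum _ fun i _ => i1 i).const_mul _) fun x => ?_
  simp only [advS_apply]
  rw [Finset.sum_comm, Finset.mul_sum]
  refine Finset.sum_le_sum fun l _ => ?_
  refine (Finset.sum_mul_sq_le_sq_mul_sq _ _ _).trans ?_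
  refine mul_le_mul_of_nonneg_right ?_ (Finset.sum_nonneg fun i _ => sq_nonneg _)
  have : ∀ i ∈ (Finset.univ : Finset (Fin 3)), U i x ^ 2 ≤ S ^ 2 := fun i _ =>
    sq_le_sq' (by linarith [neg_abs_le (U i x), hS i x]) ((le_abs_self _).trans (hS i x))
  simpa using Finset.sum_le_card_nsmul _ _ _ this

theorem lineDerivOp_advS_apply (U : Fin 3 → 𝓢(Ell 3, ℝ)) (l j : Fin 3) (x : Ell 3) :
    ∂_{eVec 3 j} (advS U l) x = ∑ i, (∂_{eVec 3 j} (U i) x * ∂_{eVec 3 i} (U l) x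
      + U i x * ∂_{eVec 3 j} (∂_{eVec 3 i} (U l)) x) := by
  have : ∂_{eVec 3 j} (advS U l) = ∑ i, ∂_{eVec 3 j} (mulS (U i) (∂_{eVec 3 i} (U l))) :=
    lineDerivOp_sum _ _ _
  rw [this, SchwartzMap.sum_apply']
  simp only [lineDerivOp_mulS]

theorem J_two_advS_le (U : Fin 3 → 𝓢(Ell 3, ℝ)) {S : ℝ} (hS : ∀ l x, |U l x| ≤ S) :
    J 2 (asm (advS U)) ≤ 168 * (2 * Real.pi) ^ 2 * S ^ 2 * J 4 (asm U) := by
  set a : Fin 3 → Fin 3 → 𝓢(Ell 3, ℝ) := fun i l => ∂_{eVec 3 i} (U l) with ha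
  set b : Fin 3 → Fin 3 → Fin 3 → 𝓢(Ell 3, ℝ) := fun j i l => ∂_{eVec 3 j} (a i l) with hb
  have h4 := sum_integral_lineDerivOp_lineDerivOp_sq U
  have hB : ∑ j, ∑ i, ∑ l, ∫ x, (b j i l x) ^ 2 = (2 * Real.pi) ^ 4 * J 4 (asm U) := by
    rw [← h4]
    refine Finset.sum_congr rfl fun j _ => Finset.sum_congr rfl fun i _ => ?_
    rw [integral_finsetSum _ fun l _ => integrable_sq _]
  have hF : ∑ j, ∑ l, ∫ x, (∂_{eVec 3 j} (advS U l) x) ^ 2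
      = (2 * Real.pi) ^ 2 * J 2 (asm (advS U)) := by
    rw [← sum_integral_lineDerivOp_sq]
    refine Finset.sum_congr rfl fun j _ => ?_
    rw [integral_finsetSum _ fun l _ => integrable_sq _]
  have hA : ∀ i l, ∫ x, (a i l x) ^ 4 ≤ 9 * S ^ 2 * ∫ x, (b i i l x) ^ 2 := fun i l =>
    integral_lineDerivOp_pow_four_le (U l) (hS l) (eVec 3 i)
  have hA' : ∑ i, ∑ l, ∫ x, (a i l x) ^ 4 ≤ 9 * S ^ 2 * ((2 * Real.pi) ^ 4 * J 4 (asm U)) := by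
    rw [← hB, Finset.mul_sum]
    refine Finset.sum_le_sum fun i _ => ?_
    refine (Finset.sum_le_sum fun l _ => hA i l).trans ?_
    rw [← Finset.mul_sum]
    refine mul_le_mul_of_nonneg_left ?_ (by positivity)
    exact Finset.single_le_sum (f := fun k => ∑ l, ∫ x, (b i k l x) ^ 2)
      (fun k _ => Finset.sum_nonneg fun l _ => integral_nonneg fun x => sq_nonneg _)
      (Finset.mem_univ i)
  have hpt : ∀ j l, ∫ x, (∂_{eVec 3 j} (advS U l) x) ^ 2 ≤ ∑ i, (3 * (∫ x, (a j i x) ^ 4)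
      + 3 * (∫ x, (a i l x) ^ 4) + 6 * S ^ 2 * ∫ x, (b j i l x) ^ 2) := by
    intro j l
    have i4 := fun i l => integrable_pow_four (a i l)
    have i2 := fun j i l => integrable_sq (b j i l)
    have i5 : ∀ i, Integrable (fun x => 3 * a j i x ^ 4 + 3 * a i l x ^ 4) := fun i =>
      ((i4 j i).const_mul 3).add ((i4 i l).const_mul 3)
    have i6 : ∀ i, Integrable (fun x => 3 * a j i x ^ 4 + 3 * a i l x ^ 4
        + 6 * S ^ 2 * b j i l x ^ 2) := fun i => (i5 i).add ((i2 j i l).const_mul _)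
    have e : ∑ i, (3 * (∫ x, (a j i x) ^ 4) + 3 * (∫ x, (a i l x) ^ 4)
        + 6 * S ^ 2 * ∫ x, (b j i l x) ^ 2)
        = ∫ x, ∑ i, (3 * a j i x ^ 4 + 3 * a i l x ^ 4 + 6 * S ^ 2 * b j i l x ^ 2) := by
      rw [integral_finsetSum _ fun i _ => i6 i]
      refine Finset.sum_congr rfl fun i _ => ?_
      rw [integral_add (i5 i) ((i2 j i l).const_mul _), integral_add ((i4 j i).const_mul 3)
        ((i4 i l).const_mul 3), integral_const_mul, integral_const_mul, integral_const_mul]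
    rw [e]
    refine integral_mono (integrable_sq _) (integrable_finsetSum _ fun i _ => i6 i) fun x => ?_
    simp only [lineDerivOp_advS_apply]
    refine sq_sum_le_card_mul_sum_sq.trans ?_
    rw [Finset.mul_sum]
    refine Finset.sum_le_sum fun i _ => ?_
    simp only [Finset.card_univ, Fintype.card_fin]
    have hs : U i x ^ 2 ≤ S ^ 2 := sq_le_sq' (by linarith [neg_abs_le (U i x), hS i x])
      ((le_abs_self _).trans (hS i x))
    have h3 := mul_le_mul_of_nonneg_right hs (sq_nonneg (b j i l x))
    change ((3:ℕ):ℝ) * (a j i x * a i l x + U i x * b j i l x) ^ 2 ≤ _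
    push_cast
    nlinarith [sq_nonneg (a j i x * a i l x - U i x * b j i l x),
      sq_nonneg (a j i x ^ 2 - a i l x ^ 2)]
  have hsum := Finset.sum_le_sum fun j (_ : j ∈ (Finset.univ : Finset (Fin 3))) =>
    Finset.sum_le_sum fun l (_ : l ∈ (Finset.univ : Finset (Fin 3))) => hpt j l
  rw [hF] at hsum
  have hK : (0:ℝ) < (2 * Real.pi) ^ 2 := by positivity
  have e : ∑ j, ∑ l, ∑ i, (3 * (∫ x, (a j i x) ^ 4) + 3 * (∫ x, (a i l x) ^ 4)
        + 6 * S ^ 2 * ∫ x, (b j i l x) ^ 2) = 18 * (∑ i, ∑ l, ∫ x, (a i l x) ^ 4)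
        + 6 * S ^ 2 * ∑ j, ∑ i, ∑ l, ∫ x, (b j i l x) ^ 2 := by
    simp only [Fin.sum_univ_three]
    ring
  rw [e, hB] at hsum
  have : (2 * Real.pi) ^ 2 * J 2 (asm (advS U))
      ≤ (2 * Real.pi) ^ 2 * (168 * (2 * Real.pi) ^ 2 * S ^ 2 * J 4 (asm U)) := by
    nlinarith
  exact le_of_mul_le_mul_left this hK

theorem fourier_rhsS (U : Fin 3 → 𝓢(Ell 3, ℝ)) (ξ : Ell 3) :
    𝓕 (asm (rhsS U)) ξ = - (((2 * Real.pi) ^ 2 * ‖ξ‖ ^ 2 : ℝ) : ℂ) • 𝓕 (asm U) ξ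
      - 𝓕 (asm (advS U)) ξ := by
  have e : asm (rhsS U) = ∑ i, ∂_{eVec 3 i} (∂_{eVec 3 i} (asm U)) - asm (advS U) := by
    have h1 : rhsS U = ∑ i, (fun l => ∂_{eVec 3 i} (∂_{eVec 3 i} (U l))) - advS U := by
      ext1 l; simp [rhsS, Finset.sum_apply]
    rw [h1, map_sub, map_sum]
    simp only [asm_lineDerivOp]
  have e2 : 𝓕 (∑ i, ∂_{eVec 3 i} (∂_{eVec 3 i} (asm U)))
      = ∑ i, 𝓕 (∂_{eVec 3 i} (∂_{eVec 3 i} (asm U))) :=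
    map_sum (FourierTransform.fourierCLM ℂ 𝓢(Ell 3, CV)) _ _
  rw [e, fourier_sub_apply, e2, SchwartzMap.sum_apply']
  simp only [fourier_lineDerivOp_apply, smul_smul, ← Finset.sum_smul]
  congr 2
  have h : ‖ξ‖ ^ 2 = ∑ i, ξ i ^ 2 := by simp [EuclideanSpace.norm_sq_eq]
  rw [h, Finset.mul_sum]
  push_cast
  rw [← Finset.sum_neg_distrib]
  refine Finset.sum_congr rfl fun i _ => ?_
  have := Complex.I_sq
  linear_combination (4 * (Real.pi:ℂ) ^ 2 * (ξ i : ℂ) ^ 2) * this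

end Nonlinear

section Bounds

theorem exists_J_advS_le : ∃ C > (0:ℝ), ∀ U : Fin 3 → 𝓢(Ell 3, ℝ),
    J 0 (asm (advS U)) ≤ C * √(J 2 (asm U) * J 4 (asm U)) * J 2 (asm U) ∧
    J 2 (asm (advS U)) ≤ C * √(J 2 (asm U) * J 4 (asm U)) * J 4 (asm U) := by
  obtain ⟨C, hC, h⟩ := agmon
  refine ⟨168 * (2 * Real.pi) ^ 2 * √C, by positivity, fun U => ?_⟩
  set q := √(J 2 (asm U) * J 4 (asm U)) with hq
  have J2 := J_nonneg 2 (asm U)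
  have J4 := J_nonneg 4 (asm U)
  have hS : ∀ l x, |U l x| ≤ √(√C * q) := by
    intro l x
    have h1 : |U l x| ^ 2 ≤ ‖asm U x‖ ^ 2 := by
      rw [norm_asm_sq, sq_abs]
      exact Finset.single_le_sum (f := fun l => U l x ^ 2) (fun _ _ => sq_nonneg _)
        (Finset.mem_univ l)
    have h2 : ‖asm U x‖ ^ 2 ≤ √C * q := by
      rw [hq, ← Real.sqrt_mul hC.le]
      refine Real.le_sqrt_of_sq_le ?_
      calc _ = ‖asm U x‖ ^ 4 := by ring
        _ ≤ _ := h _ x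
    exact Real.le_sqrt_of_sq_le (h1.trans h2)
  have hSS : √(√C * q) ^ 2 = √C * q := Real.sq_sqrt (by positivity)
  have h0 := J_zero_advS_le U hS
  have h2 := J_two_advS_le U hS
  rw [hSS] at h0 h2
  refine ⟨h0.trans ?_, h2.trans (le_of_eq (by ring))⟩
  have : 0 ≤ (2 * Real.pi) ^ 2 * (√C * q) * J 2 (asm U) := by positivity
  nlinarith

theorem sqrt_pow_three_le (f : 𝓢(Ell 3, CV)) : √(J 2 f * J 4 f) ^ 3 ≤ J 2 f ^ 2 * J 5 f := by
  have J2 := J_nonneg 2 f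
  have J4 := J_nonneg 4 f
  have J5 := J_nonneg 5 f
  have h := J_four_pow_three_le f
  refine (sq_le_sq₀ (by positivity) (by positivity)).1 ?_
  have e : (√(J 2 f * J 4 f) ^ 3) ^ 2 = (J 2 f * J 4 f) ^ 3 := by
    rw [← pow_mul, mul_comm 3 2, pow_mul, Real.sq_sqrt (by positivity)]
  rw [e]
  calc (J 2 f * J 4 f) ^ 3 = J 2 f ^ 3 * J 4 f ^ 3 := by ring
    _ ≤ J 2 f ^ 3 * (J 2 f * J 5 f ^ 2) := by gcongr
    _ = _ := by ring

theorem J_zero_rhsS_le (U : Fin 3 → 𝓢(Ell 3, ℝ)) :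
    J 0 (asm (rhsS U)) ≤ 2 * (2 * Real.pi) ^ 4 * J 4 (asm U) + 2 * J 0 (asm (advS U)) := by
  simp only [J]
  have i4 := integrable_pow_mul_norm_sq 4 (𝓕 (asm U))
  have i0 := integrable_pow_mul_norm_sq 0 (𝓕 (asm (advS U)))
  rw [← integral_const_mul, ← integral_const_mul, ← integral_add (i4.const_mul _) (i0.const_mul _)]
  refine integral_mono (integrable_pow_mul_norm_sq 0 _) ((i4.const_mul _).add (i0.const_mul _))
    fun ξ => ?_
  simp only [fourier_rhsS, pow_zero, one_mul]
  have h := norm_sub_le (-(((2 * Real.pi) ^ 2 * ‖ξ‖ ^ 2 : ℝ) : ℂ) • 𝓕 (asm U) ξ)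
    (𝓕 (asm (advS U)) ξ)
  have e : ‖-(((2 * Real.pi) ^ 2 * ‖ξ‖ ^ 2 : ℝ) : ℂ) • 𝓕 (asm U) ξ‖
      = (2 * Real.pi) ^ 2 * ‖ξ‖ ^ 2 * ‖𝓕 (asm U) ξ‖ := by
    rw [norm_smul, norm_neg, Complex.norm_real, Real.norm_of_nonneg (by positivity)]
  rw [e] at h
  set A := (2 * Real.pi) ^ 2 * ‖ξ‖ ^ 2 * ‖𝓕 (asm U) ξ‖ with hA
  have hA2 : 2 * (2 * Real.pi) ^ 4 * (‖ξ‖ ^ 4 * ‖𝓕 (asm U) ξ‖ ^ 2) = 2 * A ^ 2 := by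
    rw [hA]; ring
  rw [hA2]
  nlinarith [norm_nonneg (-(((2 * Real.pi) ^ 2 * ‖ξ‖ ^ 2 : ℝ) : ℂ) • 𝓕 (asm U) ξ
    - 𝓕 (asm (advS U)) ξ), sq_nonneg (A - ‖𝓕 (asm (advS U)) ξ‖)]

theorem exists_J_rhsS_le : ∃ C > (0:ℝ), ∀ U : Fin 3 → 𝓢(Ell 3, ℝ),
    J 0 (asm (rhsS U)) ^ 3
      ≤ C * (J 2 (asm U) * J 5 (asm U) ^ 2 + J 2 (asm U) ^ 5 * J 5 (asm U)) := by
  obtain ⟨C, hC, h⟩ := exists_J_advS_le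
  refine ⟨32 * ((2 * Real.pi) ^ 12 + C ^ 3), by positivity, fun U => ?_⟩
  have h1 := J_zero_rhsS_le U
  have h2 := (h U).1
  have h3 := sqrt_pow_three_le (asm U)
  have h4 := J_four_pow_three_le (asm U)
  set q := √(J 2 (asm U) * J 4 (asm U)) with hq
  have q0 : 0 ≤ q := Real.sqrt_nonneg _
  have J0 := J_nonneg 0 (asm (rhsS U))
  have J2 := J_nonneg 2 (asm U)
  have J4 := J_nonneg 4 (asm U)
  have J5 := J_nonneg 5 (asm U)
  set a := (2 * Real.pi) ^ 4 * J 4 (asm U) with ha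
  set b := C * q * J 2 (asm U) with hb
  have a0 : 0 ≤ a := by positivity
  have b0 : 0 ≤ b := by positivity
  have hab : J 0 (asm (rhsS U)) ≤ 2 * (a + b) := by
    rw [ha]; linarith
  have hcube : (a + b) ^ 3 ≤ 4 * (a ^ 3 + b ^ 3) := by
    nlinarith [mul_nonneg (add_nonneg a0 b0) (sq_nonneg (a - b))]
  have ha3 : a ^ 3 ≤ (2 * Real.pi) ^ 12 * (J 2 (asm U) * J 5 (asm U) ^ 2) := by
    calc a ^ 3 = (2 * Real.pi) ^ 12 * J 4 (asm U) ^ 3 := by rw [ha]; ring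
      _ ≤ _ := by gcongr
  have hb3 : b ^ 3 ≤ C ^ 3 * (J 2 (asm U) ^ 5 * J 5 (asm U)) := by
    calc b ^ 3 = C ^ 3 * (q ^ 3 * J 2 (asm U) ^ 3) := by rw [hb]; ring
      _ ≤ C ^ 3 * ((J 2 (asm U) ^ 2 * J 5 (asm U)) * J 2 (asm U) ^ 3) := by gcongr
      _ = _ := by ring
  have p1 : 0 ≤ (2 * Real.pi) ^ 12 * (J 2 (asm U) ^ 5 * J 5 (asm U)) := by positivity
  have p2 : 0 ≤ C ^ 3 * (J 2 (asm U) * J 5 (asm U) ^ 2) := by positivity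
  calc J 0 (asm (rhsS U)) ^ 3 ≤ (2 * (a + b)) ^ 3 := by gcongr
    _ = 8 * (a + b) ^ 3 := by ring
    _ ≤ 8 * (4 * (a ^ 3 + b ^ 3)) := by gcongr
    _ ≤ _ := by linarith

theorem Pm_rhsS {m : Ell 3 → ℝ} {M : ℝ} (hm : Continuous m) (hM : ∀ ξ, |m ξ| ≤ M)
    (U : Fin 3 → 𝓢(Ell 3, ℝ)) :
    Pm m (asm (rhsS U)) (asm U) = -((2 * Real.pi) ^ 2 * ∫ ξ, m ξ * ‖ξ‖ ^ 4 * ‖𝓕 (asm U) ξ‖ ^ 2)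
      - Pm m (asm (advS U)) (asm U) := by
  simp only [Pm]
  have i4 := integrable_weight_inner hm hM 4 (𝓕 (asm U)) (𝓕 (asm U))
  simp only [re_inner_self] at i4
  have i2 := integrable_weight_inner hm hM 2 (𝓕 (asm (advS U))) (𝓕 (asm U))
  have i4n : Integrable (fun ξ => -((2 * Real.pi) ^ 2 * (m ξ * ‖ξ‖ ^ 4 * ‖𝓕 (asm U) ξ‖ ^ 2))) :=
    (i4.const_mul _).neg
  rw [← integral_const_mul, ← integral_neg, ← integral_sub i4n i2]
  refine integral_congr_ae (Eventually.of_forall fun ξ => ?_)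
  simp only [fourier_rhsS, inner_sub_left, inner_smul_left, Complex.sub_re, map_neg,
    Complex.conj_ofReal]
  rw [neg_mul, Complex.neg_re, Complex.re_ofReal_mul, re_inner_self]
  ring

theorem exists_Pm_one_rhsS_le : ∃ C > (0:ℝ), ∀ U : Fin 3 → 𝓢(Ell 3, ℝ),
    2 * Pm (fun _ => 1) (asm (rhsS U)) (asm U) ≤ C * J 2 (asm U) * √(J 5 (asm U)) := by
  obtain ⟨C, hC, h⟩ := exists_J_advS_le
  refine ⟨2 * √C, by positivity, fun U => ?_⟩
  have J2 := J_nonneg 2 (asm U)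
  have J4 := J_nonneg 4 (asm U)
  have J5 := J_nonneg 5 (asm U)
  have h1 := (h U).1
  have h3 := sqrt_pow_three_le (asm U)
  have hqq : √(J 2 (asm U) * J 4 (asm U)) ^ 2 = J 2 (asm U) * J 4 (asm U) :=
    Real.sq_sqrt (by positivity)
  set q := √(J 2 (asm U) * J 4 (asm U)) with hq
  rw [Pm_rhsS (M := 1) continuous_const (by simp)]
  have h4 := abs_Pm_le (m := fun _ => (1:ℝ)) (M := 1) continuous_const (by simp)
    (asm (advS U)) (asm U)
  have h5 : √(J 0 (asm (advS U)) * J 4 (asm U)) ≤ √C * J 2 (asm U) * √(J 5 (asm U)) := by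
    refine Real.sqrt_le_iff.2 ⟨by positivity, ?_⟩
    rw [mul_pow, mul_pow, Real.sq_sqrt hC.le, Real.sq_sqrt J5]
    calc J 0 (asm (advS U)) * J 4 (asm U) ≤ (C * q * J 2 (asm U)) * J 4 (asm U) := by gcongr
      _ = C * (q * (J 2 (asm U) * J 4 (asm U))) := by ring
      _ = C * q ^ 3 := by rw [← hqq]; ring
      _ ≤ C * (J 2 (asm U) ^ 2 * J 5 (asm U)) := by gcongr
      _ = _ := by ring
  have h6 : 0 ≤ (2 * Real.pi) ^ 2 * ∫ ξ : Ell 3, 1 * ‖ξ‖ ^ 4 * ‖𝓕 (asm U) ξ‖ ^ 2 :=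
    mul_nonneg (by positivity) (integral_nonneg fun _ => by positivity)
  have h7 := neg_abs_le (Pm (fun _ => 1) (asm (advS U)) (asm U))
  linarith

theorem exists_Pm_rhsS_le : ∃ C > (0:ℝ), ∀ (m : Ell 3 → ℝ) (_ : Continuous m) (M : ℝ)
    (_ : ∀ ξ, |m ξ| ≤ M) (_ : ∀ ξ, 0 ≤ m ξ) (_ : ∀ ξ, m ξ ≤ 1 + ‖ξ‖ ^ 2)
    (U : Fin 3 → 𝓢(Ell 3, ℝ)),
    2 * Pm m (asm (rhsS U)) (asm U)
      ≤ C * √(J 2 (asm U) * J 4 (asm U)) * (J 2 (asm U) + J 4 (asm U)) := by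
  obtain ⟨C, hC, h⟩ := exists_J_advS_le
  have hK : (0:ℝ) < (2 * Real.pi) ^ 2 := by positivity
  refine ⟨(2 * (2 * Real.pi) ^ 2)⁻¹ * C, by positivity, fun m hm M hM m0 m1 U => ?_⟩
  rw [Pm_rhsS hm hM]
  set K := (2 * Real.pi) ^ 2 with hKd
  have i4 := integrable_weight_inner hm hM 4 (𝓕 (asm U)) (𝓕 (asm U))
  simp only [re_inner_self] at i4
  have i2 := integrable_weight_inner hm hM 2 (𝓕 (asm (advS U))) (𝓕 (asm U))
  have iF0 := integrable_pow_mul_norm_sq 0 (𝓕 (asm (advS U)))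
  have iF2 := integrable_pow_mul_norm_sq 2 (𝓕 (asm (advS U)))
  have key : 2 * (-(K * ∫ ξ, m ξ * ‖ξ‖ ^ 4 * ‖𝓕 (asm U) ξ‖ ^ 2) - Pm m (asm (advS U)) (asm U))
      ≤ (2 * K)⁻¹ * (J 0 (asm (advS U)) + J 2 (asm (advS U))) := by
    simp only [Pm, J]
    have i4n : Integrable (fun ξ => -(K * (m ξ * ‖ξ‖ ^ 4 * ‖𝓕 (asm U) ξ‖ ^ 2))) :=
      (i4.const_mul _).neg
    rw [← integral_const_mul, ← integral_neg, ← integral_sub i4n i2,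
      ← integral_const_mul, ← integral_add iF0 iF2, ← integral_const_mul]
    refine integral_mono ((i4n.sub i2).const_mul 2)
      ((iF0.add iF2).const_mul _) fun ξ => ?_
    simp only
    have h1 := abs_re_inner_le (𝓕 (asm (advS U)) ξ) (𝓕 (asm U) ξ)
    have h2 := (abs_le.1 h1).1
    set A := ‖𝓕 (asm (advS U)) ξ‖
    set B := ‖𝓕 (asm U) ξ‖
    set R := (inner ℂ (𝓕 (asm (advS U)) ξ) (𝓕 (asm U) ξ)).re
    have h3 : m ξ * (‖ξ‖ ^ 2 * (-R)) ≤ m ξ * (‖ξ‖ ^ 2 * (A * B)) :=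
      mul_le_mul_of_nonneg_left (mul_le_mul_of_nonneg_left (by linarith) (by positivity)) (m0 ξ)
    have h4 : 0 ≤ m ξ * (2 * K)⁻¹ * (A - 2 * K * (‖ξ‖ ^ 2 * B)) ^ 2 := by
      have := m0 ξ
      positivity
    have h5 : m ξ * (2 * K)⁻¹ * (A - 2 * K * (‖ξ‖ ^ 2 * B)) ^ 2 = m ξ * (2 * K)⁻¹ * A ^ 2
        - 2 * (m ξ * (‖ξ‖ ^ 2 * (A * B))) + 2 * (K * (m ξ * ‖ξ‖ ^ 4 * B ^ 2)) := by
      field_simp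
      ring
    have h6 : m ξ * (2 * K)⁻¹ * A ^ 2 ≤ (2 * K)⁻¹ * (‖ξ‖ ^ 0 * A ^ 2 + ‖ξ‖ ^ 2 * A ^ 2) := by
      have := mul_le_mul_of_nonneg_right (m1 ξ) (show 0 ≤ (2 * K)⁻¹ * A ^ 2 by positivity)
      calc _ = m ξ * ((2 * K)⁻¹ * A ^ 2) := by ring
        _ ≤ _ := this
        _ = _ := by ring
    linarith
  refine key.trans ?_
  have := (h U)
  calc _ ≤ (2 * K)⁻¹ * (C * √(J 2 (asm U) * J 4 (asm U)) * J 2 (asm U)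
        + C * √(J 2 (asm U) * J 4 (asm U)) * J 4 (asm U)) :=
        mul_le_mul_of_nonneg_left (by linarith) (by positivity)
    _ = _ := by ring

end Bounds

section Evolution

theorem hasDerivAt_integral_mul {T : ℝ} {f : ℝ × Ell 3 → ℝ}
    (hf : ContDiffOn ℝ 1 f (Set.Ioo 0 T ×ˢ Set.univ)) {φ : Ell 3 → ℝ} (hφ : Continuous φ)
    (hc : HasCompactSupport φ) {t : ℝ} (ht : t ∈ Set.Ioo 0 T) {f' : ℝ → Ell 3 → ℝ}
    (hf' : ∀ τ ∈ Set.Ioo 0 T, ∀ x, HasDerivAt (fun s => f (s, x)) (f' τ x) τ) :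
    Integrable (fun x => f' t x * φ x) ∧
    HasDerivAt (fun τ => ∫ x, f (τ, x) * φ x) (∫ x, f' t x * φ x) t := by
  have hO : IsOpen (Set.Ioo 0 T ×ˢ (Set.univ : Set (Ell 3))) := isOpen_Ioo.prod isOpen_univ
  have hd : ContinuousOn (fderiv ℝ f) (Set.Ioo 0 T ×ˢ Set.univ) :=
    hf.continuousOn_fderiv_of_isOpen hO le_rfl
  have e : ∀ τ ∈ Set.Ioo 0 T, ∀ x, f' τ x = fderiv ℝ f (τ, x) (1, 0) := by
    intro τ hτ x
    have h1 : HasFDerivAt f (fderiv ℝ f (τ, x)) (τ, x) :=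
      ((hf.contDiffAt (hO.mem_nhds ⟨hτ, trivial⟩)).differentiableAt one_ne_zero).hasFDerivAt
    have h2 : HasDerivAt (fun s : ℝ => ((s, x) : ℝ × Ell 3)) (1, 0) τ :=
      (hasDerivAt_id τ).prodMk (hasDerivAt_const τ x)
    exact (hf' τ hτ x).unique (h1.comp_hasDerivAt τ h2)
  have hcont : ∀ τ ∈ Set.Ioo 0 T, Continuous fun x => f (τ, x) := fun τ hτ =>
    hf.continuousOn.comp_continuous (by fun_prop) fun x => ⟨hτ, trivial⟩
  have hcont' : ∀ τ ∈ Set.Ioo 0 T, Continuous fun x => f' τ x := by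
    intro τ hτ
    have : Continuous fun x => fderiv ℝ f (τ, x) (1, 0) :=
      (hd.comp_continuous (f := fun x => (τ, x)) (by fun_prop) fun x => ⟨hτ, trivial⟩).clm_apply
        continuous_const
    exact this.congr fun x => (e τ hτ x).symm
  obtain ⟨ε, hε, hεs⟩ := Metric.nhds_basis_closedBall.mem_iff.1 (isOpen_Ioo.mem_nhds ht)
  have hK : IsCompact (Metric.closedBall t ε ×ˢ tsupport φ) :=
    (isCompact_closedBall t ε).prod hc
  have hsub : Metric.closedBall t ε ×ˢ tsupport φ ⊆ Set.Ioo 0 T ×ˢ Set.univ :=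
    Set.prod_mono hεs (Set.subset_univ _)
  obtain ⟨M, hM⟩ := hK.exists_bound_of_continuousOn
    ((hd.mono hsub).clm_apply (continuousOn_const (c := ((1, 0) : ℝ × Ell 3))))
  refine hasDerivAt_integral_of_dominated_loc_of_deriv_le (bound := fun x => M * ‖φ x‖)
    (F := fun τ x => f (τ, x) * φ x) (F' := fun τ x => f' τ x * φ x)
    (Metric.closedBall_mem_nhds t hε) ?_ ?_ ?_ ?_ ?_ ?_
  · filter_upwards [isOpen_Ioo.mem_nhds ht] with τ hτ
    exact ((hcont τ hτ).mul hφ).aestronglyMeasurable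
  · exact ((hcont t ht).mul hφ).integrable_of_hasCompactSupport hc.mul_left
  · exact ((hcont' t ht).mul hφ).aestronglyMeasurable
  · refine Eventually.of_forall fun x τ hτ => ?_
    rw [norm_mul]
    by_cases hx : x ∈ tsupport φ
    · rw [e τ (hεs hτ) x]
      exact mul_le_mul_of_nonneg_right (hM (τ, x) ⟨hτ, hx⟩) (norm_nonneg _)
    · simp [image_eq_zero_of_notMem_tsupport hx]
  · exact (hφ.integrable_of_hasCompactSupport hc).norm.const_mul M
  · exact Eventually.of_forall fun x τ hτ => (hf' τ (hεs hτ) x).mul_const _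

theorem integral_fderiv_mul_lineDerivOp_eq_zero {q : Ell 3 → ℝ} (hq : ContDiff ℝ 2 q)
    {B : Fin 3 → Fin 3 → 𝓢(Ell 3, ℝ)} (hB : ∀ i l x, B i l x = -B l i x)
    (hc : ∀ i l, HasCompactSupport (B i l)) :
    ∫ x, ∑ l, fderiv ℝ q x (eVec 3 l) * ∑ i, ∂_{eVec 3 i} (B i l) x = 0 := by
  set Q : Fin 3 → Ell 3 → ℝ := fun l x => fderiv ℝ q x (eVec 3 l) with hQ
  have hQ1 : ∀ l, ContDiff ℝ 1 (Q l) := fun l =>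
    (hq.fderiv_right (m := 1) le_rfl).clm_apply contDiff_const
  have hdQ : ∀ l v, Continuous fun x => fderiv ℝ (Q l) x v := fun l v =>
    ((hQ1 l).continuous_fderiv one_ne_zero).clm_apply continuous_const
  have hsymm : ∀ i l x, fderiv ℝ (Q l) x (eVec 3 i) = fderiv ℝ (Q i) x (eVec 3 l) := by
    intro i l x
    have h2 : DifferentiableAt ℝ (fderiv ℝ q) x :=
      ((hq.fderiv_right (m := 1) le_rfl).differentiable one_ne_zero) x
    have := (hq.contDiffAt (x := x)).isSymmSndFDerivAt (by simp)
    have e : ∀ l v, fderiv ℝ (Q l) x v = fderiv ℝ (fderiv ℝ q) x v (eVec 3 l) := by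
      intro l v
      simp only [hQ]
      rw [fderiv_clm_apply h2 (differentiableAt_const _)]
      simp
    rw [e, e]
    exact this _ _
  have hdc : ∀ i l, HasCompactSupport (fun x => ∂_{eVec 3 i} (B i l) x) := by
    intro i l
    refine ((hc i l).fderiv (𝕜 := ℝ)).mono ?_
    intro x hx hx'
    apply hx
    simp only [SchwartzMap.lineDerivOp_apply_eq_fderiv]
    rw [hx']; simp
  have hQB : ∀ i l, Integrable fun x => Q l x * ∂_{eVec 3 i} (B i l) x := fun i l =>
    ((hQ1 l).continuous.mul (∂_{eVec 3 i} (B i l)).continuous).integrable_of_hasCompactSupport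
      (hdc i l).mul_left
  have hparts : ∀ i l, ∫ x, Q l x * ∂_{eVec 3 i} (B i l) x
      = -∫ x, fderiv ℝ (Q l) x (eVec 3 i) * B i l x := by
    intro i l
    have h := hQB i l
    simp only [SchwartzMap.lineDerivOp_apply_eq_fderiv] at h ⊢
    exact integral_mul_fderiv_eq_neg_fderiv_mul_of_integrable
      (((hdQ l _).mul (B i l).continuous).integrable_of_hasCompactSupport (hc i l).mul_left) h
      (((hQ1 l).continuous.mul (B i l).continuous).integrable_of_hasCompactSupport
        (hc i l).mul_left) (fun x _ => (hQ1 l).differentiable one_ne_zero x)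
      (fun x _ => (B i l).differentiableAt)
  have hanti : ∀ i l, ∫ x, Q l x * ∂_{eVec 3 i} (B i l) x
      = -∫ x, Q i x * ∂_{eVec 3 l} (B l i) x := by
    intro i l
    rw [hparts, hparts, neg_inj, ← integral_neg]
    refine integral_congr_ae (Eventually.of_forall fun x => ?_)
    simp only
    rw [hsymm, hB i l]; ring
  simp only [Finset.mul_sum]
  rw [integral_finsetSum _ fun l _ => integrable_finsetSum _ fun i _ => hQB i l]
  simp_rw [integral_finsetSum _ fun i _ => hQB i _]
  simp only [Fin.sum_univ_three]
  linarith [hanti 0 0, hanti 1 1, hanti 2 2, hanti 0 1, hanti 0 2, hanti 1 2]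

/-- smooth cutoffs exhausting the space, with uniformly bounded first derivatives -/
theorem exists_cutoff : ∃ (X : ℕ → 𝓢(Ell 3, ℝ)) (C : ℝ), 0 ≤ C ∧ (∀ n, HasCompactSupport (X n)) ∧
    (∀ n x, |X n x - 1| ≤ 1) ∧ (∀ n i x, |∂_{eVec 3 i} (X n) x| ≤ C) ∧
    (∀ x, ∀ᶠ n in atTop, X n x = 1) ∧ (∀ i x, ∀ᶠ n in atTop, ∂_{eVec 3 i} (X n) x = 0) := by
  let χ : ContDiffBump (0 : Ell 3) := ⟨1, 2, one_pos, by norm_num⟩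
  let r : ℕ → ℝ := fun n => ((n:ℝ) + 1)⁻¹
  have hr : ∀ n, 0 < r n := fun n => by positivity
  let Y : 𝓢(Ell 3, ℝ) := χ.hasCompactSupport.toSchwartzMap χ.contDiff
  have hY : ⇑Y = χ := rfl
  have hcs : ∀ n, HasCompactSupport fun x : Ell 3 => χ (r n • x) := fun n =>
    χ.hasCompactSupport.comp_smul (hr n).ne'
  have hsm : ∀ n, ContDiff ℝ (⊤ : ℕ∞) fun x : Ell 3 => χ (r n • x) := fun n =>
    χ.contDiff.comp (contDiff_const_smul _)
  let X : ℕ → 𝓢(Ell 3, ℝ) := fun n => (hcs n).toSchwartzMap (hsm n)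
  have hX : ∀ n x, X n x = χ (r n • x) := fun n x => rfl
  have hX' : ∀ n, ⇑(X n) = fun x => χ (r n • x) := fun n => rfl
  have hdX : ∀ n i x, ∂_{eVec 3 i} (X n) x = r n * ∂_{eVec 3 i} Y (r n • x) := by
    intro n i x
    simp only [SchwartzMap.lineDerivOp_apply_eq_fderiv]
    rw [hX', hY]
    have h1 : HasFDerivAt χ (fderiv ℝ χ (r n • x)) (r n • x) :=
      (Y.differentiableAt (x := r n • x)).hasFDerivAt
    have h2 : HasFDerivAt (fun y : Ell 3 => r n • y) (r n • ContinuousLinearMap.id ℝ (Ell 3)) x :=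
      (hasFDerivAt_id x).const_smul (r n)
    have h3 : HasFDerivAt (fun y : Ell 3 => χ (r n • y)) _ x := h1.comp x h2
    rw [h3.fderiv]
    simp
  have hlt : ∀ x : Ell 3, ∀ᶠ n in atTop, ‖r n • x‖ < 1 := by
    intro x
    have : Tendsto (fun n => r n • x) atTop (nhds ((0:ℝ) • x)) :=
      (tendsto_inv_atTop_zero.comp (tendsto_atTop_add_const_right _ _
        tendsto_natCast_atTop_atTop)).smul_const x
    rw [zero_smul] at this
    simpa using this.eventually (Metric.ball_mem_nhds (0 : Ell 3) one_pos)
  have hone : ∀ y : Ell 3, ‖y‖ < 1 → χ y = 1 := fun y hy =>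
    χ.one_of_mem_closedBall (by simpa using hy.le)
  have hC : ∃ C, 0 ≤ C ∧ ∀ i x, |∂_{eVec 3 i} Y x| ≤ C := by
    refine ⟨∑ i, SchwartzMap.seminorm ℝ 0 0 (∂_{eVec 3 i} Y),
      Finset.sum_nonneg fun i _ => apply_nonneg _ _, fun i x => ?_⟩
    refine (SchwartzMap.norm_le_seminorm ℝ (∂_{eVec 3 i} Y) x).trans ?_
    exact Finset.single_le_sum (f := fun i => SchwartzMap.seminorm ℝ 0 0 (∂_{eVec 3 i} Y))
      (fun i _ => apply_nonneg _ _) (Finset.mem_univ i)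
  obtain ⟨C, hC0, hC⟩ := hC
  refine ⟨X, C, hC0, hcs, ?_, ?_, ?_, ?_⟩
  · intro n x
    rw [hX, abs_le]
    constructor <;> linarith [χ.nonneg (x := r n • x), χ.le_one (x := r n • x)]
  · intro n i x
    rw [hdX, abs_mul, abs_of_pos (hr n)]
    have : r n ≤ 1 := by
      simp only [r]; exact inv_le_one_of_one_le₀ (by linarith [n.cast_nonneg (α := ℝ)])
    calc r n * |∂_{eVec 3 i} Y (r n • x)| ≤ 1 * C := by
          gcongr; exact hC _ _
      _ = C := one_mul C
  · intro x
    filter_upwards [hlt x] with n hn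
    rw [hX, hone _ hn]
  · intro i x
    filter_upwards [hlt x] with n hn
    rw [hdX, SchwartzMap.lineDerivOp_apply_eq_fderiv]
    have : ⇑Y =ᶠ[nhds (r n • x)] fun _ => 1 := by
      filter_upwards [Metric.isOpen_ball.mem_nhds (show r n • x ∈ Metric.ball (0 : Ell 3) 1 by
        simpa using hn)] with y hy
      exact hone y (by simpa using hy)
    rw [this.fderiv_eq]
    simp

end Evolution

section RealEvolution

/-- the divergence, in the first index, of a Schwartz matrix field -/
def divS (A : Fin 3 → Fin 3 → 𝓢(Ell 3, ℝ)) : Fin 3 → 𝓢(Ell 3, ℝ) :=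
  fun l => ∑ i, ∂_{eVec 3 i} (A i l)

theorem divS_apply (A : Fin 3 → Fin 3 → 𝓢(Ell 3, ℝ)) (l : Fin 3) (x : Ell 3) :
    divS A l x = ∑ i, ∂_{eVec 3 i} (A i l) x := by
  simp only [divS, SchwartzMap.sum_apply']

theorem integrable_sum_sq (a : Fin 3 → 𝓢(Ell 3, ℝ)) : Integrable fun x => ∑ l, a l x ^ 2 :=
  integrable_finsetSum _ fun l _ => integrable_sq (a l)

theorem abs_integral_sum_mul_le (a b : Fin 3 → 𝓢(Ell 3, ℝ)) :
    |∫ x, ∑ l, a l x * b l x| ≤ √(∫ x, ∑ l, a l x ^ 2) * √(∫ x, ∑ l, b l x ^ 2) := by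
  have hcs : ∀ x, |∑ l, a l x * b l x| ≤ √(∑ l, a l x ^ 2) * √(∑ l, b l x ^ 2) := by
    intro x
    rw [← Real.sqrt_mul (Finset.sum_nonneg fun _ _ => sq_nonneg _)]
    exact Real.abs_le_sqrt (Finset.sum_mul_sq_le_sq_mul_sq _ _ _)
  have hi : Integrable fun x => ∑ l, a l x * b l x :=
    integrable_finsetSum _ fun l _ => integrable_mul _ _
  have hsq : ∀ (c : Fin 3 → 𝓢(Ell 3, ℝ)) x, √(∑ l, c l x ^ 2) ^ 2 = ∑ l, c l x ^ 2 :=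
    fun c x => Real.sq_sqrt (Finset.sum_nonneg fun _ _ => sq_nonneg _)
  have hc : ∀ c : Fin 3 → 𝓢(Ell 3, ℝ), Continuous fun x => √(∑ l, c l x ^ 2) := fun c =>
    Real.continuous_sqrt.comp (continuous_finsetSum _ fun l _ => (c l).continuous.pow 2)
  have hab : Integrable fun x => √(∑ l, a l x ^ 2) * √(∑ l, b l x ^ 2) := by
    refine ((integrable_sum_sq a).add (integrable_sum_sq b)).mono'
      ((hc a).mul (hc b)).aestronglyMeasurable (Eventually.of_forall fun x => ?_)
    rw [Real.norm_of_nonneg (by positivity)]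
    simp only [Pi.add_apply]
    nlinarith [hsq a x, hsq b x, sq_nonneg (√(∑ l, a l x ^ 2) - √(∑ l, b l x ^ 2)),
      sq_nonneg (√(∑ l, a l x ^ 2)), sq_nonneg (√(∑ l, b l x ^ 2))]
  have h1 := integral_mul_sq_le (μ := volume) (f := fun x => √(∑ l, a l x ^ 2))
    (g := fun x => √(∑ l, b l x ^ 2)) (by simpa only [hsq] using integrable_sum_sq a)
    (by simpa only [hsq] using integrable_sum_sq b) hab
  simp only [hsq] at h1
  rw [← Real.sqrt_mul (integral_nonneg fun x => Finset.sum_nonneg fun _ _ => sq_nonneg _)]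
  refine Real.le_sqrt_of_sq_le ((pow_le_pow_left₀ (abs_nonneg _) ?_ 2).trans h1)
  calc |∫ x, ∑ l, a l x * b l x| ≤ ∫ x, |∑ l, a l x * b l x| := abs_integral_le_integral_abs
    _ ≤ _ := integral_mono hi.abs hab hcs

theorem exists_compactSupport_approx {A : Fin 3 → Fin 3 → 𝓢(Ell 3, ℝ)}
    (hA : ∀ i l x, A i l x = -A l i x) : ∃ Q : ℕ → Fin 3 → Fin 3 → 𝓢(Ell 3, ℝ),
    (∀ n i l x, Q n i l x = -Q n l i x) ∧ (∀ n i l, HasCompactSupport (Q n i l)) ∧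
    Tendsto (fun n => ∫ x, ∑ l, (divS (Q n) - divS A) l x ^ 2) atTop (nhds 0) := by
  obtain ⟨X, C, hC0, hXc, hX1, hXd, hXe, hXde⟩ := exists_cutoff
  refine ⟨fun n i l => mulS (X n) (A i l), fun n i l x => ?_, fun n i l => ?_, ?_⟩
  · simp only [mulS_apply, hA i l]; ring
  · have : ⇑(mulS (X n) (A i l)) = fun x => X n x * A i l x := by
      ext x; exact mulS_apply _ _ x
    rw [this]
    exact (hXc n).mul_right
  have e : ∀ n l x, (divS (fun i l => mulS (X n) (A i l)) - divS A) l x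
      = ∑ i, (∂_{eVec 3 i} (X n) x * A i l x + (X n x - 1) * ∂_{eVec 3 i} (A i l) x) := by
    intro n l x
    rw [Pi.sub_apply, sub_apply, divS_apply, divS_apply, ← Finset.sum_sub_distrib]
    refine Finset.sum_congr rfl fun i _ => ?_
    rw [lineDerivOp_mulS]; ring
  have hlim : Tendsto (fun n => ∫ x, ∑ l, (divS (fun i l => mulS (X n) (A i l)) - divS A) l x ^ 2)
      atTop (nhds (∫ _ : Ell 3, (0:ℝ))) := by
    refine tendsto_integral_of_dominated_convergence
      (fun x => ∑ l, ∑ i, 6 * (C ^ 2 * A i l x ^ 2 + ∂_{eVec 3 i} (A i l) x ^ 2))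
      (fun n => (integrable_sum_sq _).aestronglyMeasurable)
      (integrable_finsetSum _ fun l _ => integrable_finsetSum _ fun i _ =>
        (((integrable_sq _).const_mul _).add (integrable_sq _)).const_mul _)
      (fun n => Eventually.of_forall fun x => ?_) (Eventually.of_forall fun x => ?_)
    · rw [Real.norm_of_nonneg (Finset.sum_nonneg fun _ _ => sq_nonneg _)]
      refine Finset.sum_le_sum fun l _ => ?_
      rw [e]
      refine sq_sum_le_card_mul_sum_sq.trans ?_
      rw [Finset.mul_sum]
      refine Finset.sum_le_sum fun i _ => ?_
      simp only [Finset.card_univ, Fintype.card_fin]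
      have h1 : (∂_{eVec 3 i} (X n) x) ^ 2 ≤ C ^ 2 := sq_le_sq.2 (by
        rw [abs_of_nonneg hC0]; exact hXd n i x)
      have h2 : (X n x - 1) ^ 2 ≤ 1 := by
        rw [← sq_abs]; exact pow_le_one₀ (abs_nonneg _) (hX1 n x)
      set a := A i l x
      set b := ∂_{eVec 3 i} (A i l) x
      set y := ∂_{eVec 3 i} (X n) x
      set z := X n x - 1
      have h3 := mul_le_mul_of_nonneg_right h1 (sq_nonneg a)
      have h4 := mul_le_mul_of_nonneg_right h2 (sq_nonneg b)
      push_cast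
      nlinarith [sq_nonneg (y * a - z * b)]
    · refine tendsto_const_nhds.congr' ?_
      filter_upwards [hXe x, eventually_all.2 fun i => hXde i x] with n h1 h2
      simp only [e, h1, h2]
      simp
  simpa using hlim

variable {T : ℝ} {u : ℝ → Ell 3 → Fin 3 → ℝ} {p : ℝ → Ell 3 → ℝ}
  {U : ℝ → Fin 3 → 𝓢(Ell 3, ℝ)}

theorem hasDerivAt_of_solution (h : IsNSSolution T u p)
    (hU : ∀ t ∈ Set.Ico 0 T, ∀ l x, u t x l = U t l x) {t : ℝ} (ht : t ∈ Set.Ioo 0 T)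
    (l : Fin 3) (x : Ell 3) : HasDerivAt (fun s => u s x l)
      (rhsS (U t) l x - fderiv ℝ (fun z => p t z) x (eVec 3 l)) t := by
  obtain ⟨-, -, -, -, h5⟩ := h
  have ht' : t ∈ Set.Ico 0 T := ⟨ht.1.le, ht.2⟩
  have := (h5 t ht' x l).hasDerivAt (Ico_mem_nhds ht.1 ht.2)
  refine this.congr_deriv ?_
  simp only [rhsS, sub_apply, SchwartzMap.sum_apply', advS_apply,
    SchwartzMap.lineDerivOp_apply_eq_fderiv, hU t ht']
  congr 2

theorem integral_sub_mul_divS_le_of_compactSupport (h : IsNSSolution T u p)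
    (hU : ∀ t ∈ Set.Ico 0 T, ∀ l x, u t x l = U t l x)
    {Q : Fin 3 → Fin 3 → 𝓢(Ell 3, ℝ)} (hQ : ∀ i l x, Q i l x = -Q l i x)
    (hc : ∀ i l, HasCompactSupport (Q i l)) {s t g : ℝ} (hs : 0 < s) (hst : s ≤ t) (ht : t < T)
    (hg : ∀ τ ∈ Set.Icc s t, ∫ x, ∑ l, rhsS (U τ) l x * divS Q l x ≤ g) :
    ∫ x, ∑ l, (U t - U s) l x * divS Q l x ≤ (t - s) * g := by
  have hcd : ∀ l, HasCompactSupport (divS Q l) := by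
    intro l
    have : ⇑(divS Q l) = fun x => ∑ i, ∂_{eVec 3 i} (Q i l) x := by
      ext x; exact divS_apply Q l x
    rw [this]
    have hdc : ∀ i, HasCompactSupport (fun x => ∂_{eVec 3 i} (Q i l) x) := by
      intro i
      refine ((hc i l).fderiv (𝕜 := ℝ)).mono ?_
      intro x hx hx'
      apply hx
      simp only [SchwartzMap.lineDerivOp_apply_eq_fderiv]
      rw [hx']; simp
    simp only [Fin.sum_univ_three]
    exact ((hdc 0).add (hdc 1)).add (hdc 2)
  have hder : ∀ τ ∈ Set.Icc s t, HasDerivAt (fun τ => ∑ l, ∫ x, u τ x l * divS Q l x)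
      (∫ x, ∑ l, rhsS (U τ) l x * divS Q l x) τ := by
    intro τ hτ
    have hτ' : τ ∈ Set.Ioo 0 T := ⟨hs.trans_le hτ.1, hτ.2.trans_lt ht⟩
    have hd := fun l => hasDerivAt_integral_mul (f := fun q => u q.1 q.2 l) (T := T)
      (((h.1 l).of_le (by simp)).mono (Set.prod_mono Set.Ioo_subset_Ico_self subset_rfl))
      (divS Q l).continuous (hcd l) hτ'
      (f' := fun t x => rhsS (U t) l x - fderiv ℝ (fun z => p t z) x (eVec 3 l))
      (fun τ hτ x => hasDerivAt_of_solution h hU hτ l x)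
    have hsum := HasDerivAt.fun_sum (u := Finset.univ) fun l _ => (hd l).2
    refine hsum.congr_deriv ?_
    have hp : ContDiff ℝ 2 (fun z => p τ z) := by
      have := h.2.1.comp_contDiff (g := fun q : ℝ × Ell 3 => p q.1 q.2)
        (f := fun z : Ell 3 => (τ, z)) (by fun_prop) fun x => ⟨⟨hτ'.1.le, hτ'.2⟩, trivial⟩
      exact this.of_le (by norm_cast)
    have hzero := integral_fderiv_mul_lineDerivOp_eq_zero hp hQ hc
    simp only [← divS_apply] at hzero
    have i1 : ∀ l, Integrable fun x => rhsS (U τ) l x * divS Q l x := fun l => integrable_mul _ _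
    have i2 : ∀ l, Integrable fun x =>
        fderiv ℝ (fun z => p τ z) x (eVec 3 l) * divS Q l x := by
      intro l
      refine ((i1 l).sub (hd l).1).congr (Eventually.of_forall fun x => ?_)
      simp only [Pi.sub_apply]; ring
    rw [integral_finsetSum _ fun l _ => i2 l] at hzero
    rw [integral_finsetSum _ fun l _ => i1 l]
    have : ∀ l, ∫ x, (rhsS (U τ) l x - fderiv ℝ (fun z => p τ z) x (eVec 3 l)) * divS Q l x
        = (∫ x, rhsS (U τ) l x * divS Q l x)
          - ∫ x, fderiv ℝ (fun z => p τ z) x (eVec 3 l) * divS Q l x := by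
      intro l
      rw [← integral_sub (i1 l) (i2 l)]
      simp only [sub_mul]
    simp only [this, Finset.sum_sub_distrib, hzero, sub_zero]
  have hmv := (convex_Icc s t).image_sub_le_mul_sub_of_deriv_le
    (f := fun τ => ∑ l, ∫ x, u τ x l * divS Q l x) (C := g)
    (fun τ hτ => (hder τ hτ).continuousAt.continuousWithinAt)
    (fun τ hτ => (hder τ (interior_subset hτ)).differentiableAt.differentiableWithinAt)
    (fun τ hτ => by
      rw [(hder τ (interior_subset hτ)).deriv]; exact hg τ (interior_subset hτ))
    s ⟨le_rfl, hst⟩ t ⟨hst, le_rfl⟩ hst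
  have e : ∫ x, ∑ l, (U t - U s) l x * divS Q l x
      = (∑ l, ∫ x, u t x l * divS Q l x) - ∑ l, ∫ x, u s x l * divS Q l x := by
    rw [integral_finsetSum _ fun l _ => integrable_mul _ _, ← Finset.sum_sub_distrib]
    refine Finset.sum_congr rfl fun l _ => ?_
    simp only [hU t ⟨hs.le.trans hst, ht⟩, hU s ⟨hs.le, hst.trans_lt ht⟩]
    rw [← integral_sub (integrable_mul _ _) (integrable_mul _ _)]
    simp only [Pi.sub_apply, sub_apply, sub_mul]
  rw [e, mul_comm]
  exact hmv

theorem integral_sub_mul_divS_le (h : IsNSSolution T u p)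
    (hU : ∀ t ∈ Set.Ico 0 T, ∀ l x, u t x l = U t l x)
    {A : Fin 3 → Fin 3 → 𝓢(Ell 3, ℝ)} (hA : ∀ i l x, A i l x = -A l i x)
    {s t g B : ℝ} (hs : 0 < s) (hst : s ≤ t) (ht : t < T)
    (hB : ∀ τ ∈ Set.Icc s t, ∫ x, ∑ l, rhsS (U τ) l x ^ 2 ≤ B)
    (hg : ∀ τ ∈ Set.Icc s t, ∫ x, ∑ l, rhsS (U τ) l x * divS A l x ≤ g) :
    ∫ x, ∑ l, (U t - U s) l x * divS A l x ≤ (t - s) * g := by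
  obtain ⟨Q, hQ, hc, hlim⟩ := exists_compactSupport_approx hA
  have hadd : ∀ (a : Fin 3 → 𝓢(Ell 3, ℝ)) n, ∫ x, ∑ l, a l x * divS (Q n) l x
      = (∫ x, ∑ l, a l x * divS A l x) + ∫ x, ∑ l, a l x * (divS (Q n) - divS A) l x := by
    intro a n
    rw [← integral_add (integrable_finsetSum _ fun l _ => integrable_mul _ _)
      (integrable_finsetSum _ fun l _ => integrable_mul _ _)]
    refine integral_congr_ae (Eventually.of_forall fun x => ?_)
    simp only [← Finset.sum_add_distrib, Pi.sub_apply, sub_apply]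
    refine Finset.sum_congr rfl fun l _ => ?_
    ring
  set ε : ℕ → ℝ := fun n => √(∫ x, ∑ l, (divS (Q n) - divS A) l x ^ 2) with hε
  have hε0 : Tendsto ε atTop (nhds 0) := by
    have := hlim.sqrt
    rwa [Real.sqrt_zero] at this
  set b := √(∫ x, ∑ l, (U t - U s) l x ^ 2)
  have key : ∀ n, ∫ x, ∑ l, (U t - U s) l x * divS A l x
      ≤ (t - s) * (g + √B * ε n) + b * ε n := by
    intro n
    have h1 := integral_sub_mul_divS_le_of_compactSupport h hU (hQ n) (hc n) hs hst ht
      (g := g + √B * ε n) (fun τ hτ => by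
        rw [hadd]
        refine add_le_add (hg τ hτ) ((le_abs_self _).trans
          ((abs_integral_sum_mul_le _ _).trans ?_))
        exact mul_le_mul_of_nonneg_right (Real.sqrt_le_sqrt (hB τ hτ)) (Real.sqrt_nonneg _))
    rw [hadd] at h1
    have h2 := (neg_abs_le _).trans' (neg_le_neg
      (abs_integral_sum_mul_le (U t - U s) (divS (Q n) - divS A)))
    linarith
  have hL : Tendsto (fun n => (t - s) * (g + √B * ε n) + b * ε n) atTop
      (nhds ((t - s) * (g + √B * 0) + b * 0)) :=
    ((tendsto_const_nhds.add (hε0.const_mul _)).const_mul _).add (hε0.const_mul _)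
  have := ge_of_tendsto' hL key
  simpa using this

end RealEvolution

section FourierEvolution

/-- complexification of a real Schwartz function -/
def toC : 𝓢(Ell 3, ℝ) →L[ℝ] 𝓢(Ell 3, ℂ) := postcompCLM Complex.ofRealCLM

/-- real part of a complex Schwartz function -/
def reS : 𝓢(Ell 3, ℂ) →L[ℝ] 𝓢(Ell 3, ℝ) := postcompCLM Complex.reCLM

theorem toC_apply (f : 𝓢(Ell 3, ℝ)) (x : Ell 3) : toC f x = (f x : ℂ) := rfl

theorem reS_apply (f : 𝓢(Ell 3, ℂ)) (x : Ell 3) : reS f x = (f x).re := rfl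

theorem lineDerivOp_toC (f : 𝓢(Ell 3, ℝ)) (v : Ell 3) : ∂_{v} (toC f) = toC (∂_{v} f) := by
  ext x
  rw [toC_apply, SchwartzMap.lineDerivOp_apply_eq_fderiv, SchwartzMap.lineDerivOp_apply_eq_fderiv]
  have h : HasFDerivAt (⇑(toC f)) _ x :=
    Complex.ofRealCLM.hasFDerivAt.comp x (f.differentiableAt (x := x)).hasFDerivAt
  rw [h.fderiv]; rfl

theorem lineDerivOp_reS (f : 𝓢(Ell 3, ℂ)) (v : Ell 3) : ∂_{v} (reS f) = reS (∂_{v} f) := by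
  ext x
  rw [reS_apply, SchwartzMap.lineDerivOp_apply_eq_fderiv, SchwartzMap.lineDerivOp_apply_eq_fderiv]
  have h : HasFDerivAt (⇑(reS f)) _ x :=
    Complex.reCLM.hasFDerivAt.comp x (f.differentiableAt (x := x)).hasFDerivAt
  rw [h.fderiv]; rfl

theorem fourier_lineDerivOp_apply_complex (f : 𝓢(Ell 3, ℂ)) (i : Fin 3) (ξ : Ell 3) :
    𝓕 (∂_{eVec 3 i} f) ξ = (2 * Real.pi * Complex.I * ξ i) * 𝓕 f ξ := by
  rw [SchwartzMap.fourier_lineDerivOp_eq, smul_apply,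
    smulLeftCLM_apply_apply (by fun_prop)]
  simp only [eVec, EuclideanSpace.inner_single_right]
  simp [mul_assoc]

theorem fourier_asm_eq_toC (U : Fin 3 → 𝓢(Ell 3, ℝ)) (ξ : Ell 3) (l : Fin 3) :
    𝓕 (asm U) ξ l = 𝓕 (toC (U l)) ξ := by
  rw [fourier_asm_apply, SchwartzMap.fourier_coe]; rfl

theorem integrable_inner_complex (f g : 𝓢(Ell 3, ℂ)) :
    Integrable fun x => inner ℂ (f x) (g x) := by
  refine (((f.integrable (μ := volume)).norm).mul_const (SchwartzMap.seminorm ℝ 0 0 g)).mono'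
    (f.continuous.inner g.continuous).aestronglyMeasurable (Eventually.of_forall fun x => ?_)
  exact (norm_inner_le_norm _ _).trans
    (mul_le_mul_of_nonneg_left (SchwartzMap.norm_le_seminorm ℝ g x) (norm_nonneg _))

theorem integral_mul_reS (f : 𝓢(Ell 3, ℝ)) (g : 𝓢(Ell 3, ℂ)) :
    ∫ x, f x * reS g x = ∫ ξ, (inner ℂ (𝓕 (toC f) ξ) (𝓕 g ξ)).re := by
  have h := congrArg Complex.re (SchwartzMap.integral_inner_fourier_fourier (toC f) g)
  have h1 := integral_re (integrable_inner_complex (𝓕 (toC f)) (𝓕 g))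
  have h2 := integral_re (integrable_inner_complex (toC f) g)
  simp only [RCLike.re_eq_complex_re] at h1 h2
  rw [h1, h, ← h2]
  refine integral_congr_ae (Eventually.of_forall fun x => ?_)
  simp [toC_apply, reS_apply, mul_comm]

theorem sum_mul_fourier_eq_zero {W : Fin 3 → 𝓢(Ell 3, ℝ)}
    (hW : ∀ x, ∑ i, ∂_{eVec 3 i} (W i) x = 0) (ξ : Ell 3) :
    ∑ i, (ξ i : ℂ) * 𝓕 (toC (W i)) ξ = 0 := by
  have h0 : ∑ i, ∂_{eVec 3 i} (toC (W i)) = 0 := by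
    ext x
    rw [SchwartzMap.sum_apply']
    simp only [lineDerivOp_toC, toC_apply]
    have := hW x
    simpa using congrArg (fun r : ℝ => (r : ℂ)) this
  have h1 := congrArg (fun f => (FourierTransform.fourierCLM ℂ 𝓢(Ell 3, ℂ) f) ξ) h0
  simp only [map_sum, map_zero, SchwartzMap.sum_apply', FourierTransform.fourierCLM_apply,
    fourier_lineDerivOp_apply_complex, mul_assoc, ← Finset.mul_sum, zero_apply] at h1
  have hπ : (Real.pi : ℂ) ≠ 0 := by exact_mod_cast Real.pi_ne_zero
  simpa [hπ] using h1

/-- For a divergence-free field `W` and a real multiplier `m`, the field with Fourier transform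
`|2πξ|² m(ξ) Ŵ(ξ)` is, after taking real parts, the divergence of an antisymmetric matrix field. -/
theorem exists_antisymm_divS {m : Ell 3 → ℝ} (hm : m.HasTemperateGrowth) {W : Fin 3 → 𝓢(Ell 3, ℝ)}
    (hW : ∀ x, ∑ i, ∂_{eVec 3 i} (W i) x = 0) :
    ∃ A : Fin 3 → Fin 3 → 𝓢(Ell 3, ℝ), (∀ i l x, A i l x = -A l i x) ∧
      ∀ N : Fin 3 → 𝓢(Ell 3, ℝ), ∫ x, ∑ l, N l x * divS A l x
        = (2 * Real.pi) ^ 2 * Pm m (asm N) (asm W) := by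
  have hmc : (fun ξ => (m ξ : ℂ)).HasTemperateGrowth := by fun_prop
  set V : Fin 3 → 𝓢(Ell 3, ℂ) := fun i =>
    𝓕⁻ (smulLeftCLM ℂ (fun ξ => (m ξ : ℂ)) (𝓕 (toC (W i)))) with hV
  have hVf : ∀ i ξ, 𝓕 (V i) ξ = m ξ * 𝓕 (toC (W i)) ξ := by
    intro i ξ
    simp only [hV, FourierTransform.fourier_fourierInv_eq]
    rw [smulLeftCLM_apply_apply hmc, smul_eq_mul]
  set G : Fin 3 → 𝓢(Ell 3, ℂ) := fun l =>
    ∑ i, ∂_{eVec 3 i} (∂_{eVec 3 l} (V i) - ∂_{eVec 3 i} (V l)) with hG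
  have hGf : ∀ l ξ, 𝓕 (G l) ξ
      = (((2 * Real.pi) ^ 2 * (m ξ * ‖ξ‖ ^ 2) : ℝ) : ℂ) * 𝓕 (toC (W l)) ξ := by
    intro l ξ
    have h1 : 𝓕 (G l) ξ = ∑ i, 𝓕 (∂_{eVec 3 i} (∂_{eVec 3 l} (V i) - ∂_{eVec 3 i} (V l))) ξ := by
      rw [← SchwartzMap.sum_apply']
      exact congrArg (fun f : 𝓢(Ell 3, ℂ) => f ξ)
        (map_sum (FourierTransform.fourierCLM ℂ 𝓢(Ell 3, ℂ)) _ _)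
    have h2 : ∀ f g : 𝓢(Ell 3, ℂ), 𝓕 (f - g) ξ = 𝓕 f ξ - 𝓕 g ξ := fun f g => by
      rw [← sub_apply]
      exact congrArg (fun f : 𝓢(Ell 3, ℂ) => f ξ)
        (map_sub (FourierTransform.fourierCLM ℂ 𝓢(Ell 3, ℂ)) _ _)
    have h3 := sum_mul_fourier_eq_zero hW ξ
    have h4 : ((‖ξ‖ ^ 2 : ℝ) : ℂ) = ∑ i, (ξ i : ℂ) ^ 2 := by
      rw [EuclideanSpace.real_norm_sq_eq]; push_cast; rfl
    rw [h1]
    simp only [fourier_lineDerivOp_apply_complex, h2, hVf]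
    rw [Complex.ofReal_mul, Complex.ofReal_mul, h4]
    simp only [Fin.sum_univ_three] at h3 ⊢
    push_cast
    have hI : Complex.I ^ 2 = -1 := Complex.I_sq
    linear_combination (-(2 * (Real.pi : ℂ)) ^ 2 * ξ l * m ξ) * h3
      + ((2 * (Real.pi : ℂ)) ^ 2 * m ξ * (ξ l * (ξ 0 * 𝓕 (toC (W 0)) ξ + ξ 1 * 𝓕 (toC (W 1)) ξ
        + ξ 2 * 𝓕 (toC (W 2)) ξ) - ((ξ 0 : ℂ) ^ 2 + (ξ 1 : ℂ) ^ 2 + (ξ 2 : ℂ) ^ 2)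
          * 𝓕 (toC (W l)) ξ)) * hI
  refine ⟨fun i l => reS (∂_{eVec 3 l} (V i) - ∂_{eVec 3 i} (V l)), fun i l x => ?_, fun N => ?_⟩
  · simp only [reS_apply, sub_apply, Complex.sub_re]; ring
  have hdiv : ∀ l, divS (fun i l => reS (∂_{eVec 3 l} (V i) - ∂_{eVec 3 i} (V l))) l
      = reS (G l) := by
    intro l
    simp only [divS, hG, map_sum, lineDerivOp_reS]
  simp only [hdiv]
  rw [integral_finsetSum _ fun l _ => integrable_mul _ _]
  simp only [integral_mul_reS]
  have hi : ∀ l, Integrable fun ξ => (inner ℂ (𝓕 (toC (N l)) ξ) (𝓕 (G l) ξ)).re :=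
    fun l => (integrable_inner_complex _ _).re
  rw [← integral_finsetSum _ fun l _ => hi l, Pm, ← integral_const_mul]
  refine integral_congr_ae (Eventually.of_forall fun ξ => ?_)
  simp only [hGf, PiLp.inner_apply, fourier_asm_eq_toC, Complex.re_sum, Finset.mul_sum]
  refine Finset.sum_congr rfl fun l _ => ?_
  rw [← smul_eq_mul, inner_smul_right, Complex.re_ofReal_mul]
  ring

variable {T : ℝ} {u : ℝ → Ell 3 → Fin 3 → ℝ} {p : ℝ → Ell 3 → ℝ}
  {U : ℝ → Fin 3 → 𝓢(Ell 3, ℝ)}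

theorem sum_lineDerivOp_eq_zero (h : IsNSSolution T u p)
    (hU : ∀ t ∈ Set.Ico 0 T, ∀ l x, u t x l = U t l x) {t : ℝ} (ht : t ∈ Set.Ico 0 T) (x : Ell 3) :
    ∑ i, ∂_{eVec 3 i} (U t i) x = 0 := by
  obtain ⟨-, -, -, h4, -⟩ := h
  have := h4 t ht x
  simpa only [SchwartzMap.lineDerivOp_apply_eq_fderiv, hU t ht] using this

theorem Pm_sub_le (h : IsNSSolution T u p)
    (hU : ∀ t ∈ Set.Ico 0 T, ∀ l x, u t x l = U t l x)
    {m : Ell 3 → ℝ} (hm : m.HasTemperateGrowth)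
    {W : Fin 3 → 𝓢(Ell 3, ℝ)} (hW : ∀ x, ∑ i, ∂_{eVec 3 i} (W i) x = 0)
    {s t g B : ℝ} (hs : 0 < s) (hst : s ≤ t) (ht : t < T)
    (hB : ∀ τ ∈ Set.Icc s t, J 0 (asm (rhsS (U τ))) ≤ B)
    (hg : ∀ τ ∈ Set.Icc s t, Pm m (asm (rhsS (U τ))) (asm W) ≤ g) :
    Pm m (asm (U t) - asm (U s)) (asm W) ≤ (t - s) * g := by
  obtain ⟨A, hA, hN⟩ := exists_antisymm_divS hm hW
  have hK : (0:ℝ) < (2 * Real.pi) ^ 2 := by positivity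
  have := integral_sub_mul_divS_le h hU hA (g := (2 * Real.pi) ^ 2 * g) hs hst ht
    (fun τ hτ => by rw [← J_zero_asm]; exact hB τ hτ)
    (fun τ hτ => by rw [hN]; exact mul_le_mul_of_nonneg_left (hg τ hτ) hK.le)
  rw [hN, map_sub] at this
  have h2 : (2 * Real.pi) ^ 2 * Pm m (asm (U t) - asm (U s)) (asm W)
      ≤ (2 * Real.pi) ^ 2 * ((t - s) * g) := by linarith
  exact le_of_mul_le_mul_left h2 hK

end FourierEvolution

section RealAnalysis

theorem sub_le_of_local {E : ℝ → ℝ} {s t g : ℝ} (hst : s ≤ t)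
    (H : ∀ ε > 0, ∃ δ > 0, ∀ s' t', s ≤ s' → s' ≤ t' → t' ≤ t → t' - s' ≤ δ →
      E t' - E s' ≤ (t' - s') * (g + ε)) : E t - E s ≤ (t - s) * g := by
  have key : ∀ ε > 0, E t - E s ≤ (t - s) * (g + ε) := by
    intro ε hε
    obtain ⟨δ, hδ, hl⟩ := H ε hε
    have ind : ∀ n : ℕ, ∀ x, s ≤ x → x ≤ t → x - s ≤ n * δ → E x - E s ≤ (x - s) * (g + ε) := by
      intro n
      induction n with
      | zero =>
        intro x h1 h2 h3
        have : x = s := by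
          simp only [Nat.cast_zero, zero_mul] at h3; linarith
        simp [this]
      | succ n ih =>
        intro x h1 h2 h3
        push_cast at h3
        have hy1 : s ≤ max s (x - δ) := le_max_left _ _
        have hy2 : max s (x - δ) ≤ x := max_le h1 (by linarith)
        have a1 := ih (max s (x - δ)) hy1 (hy2.trans h2) (by
          rw [max_sub_sub_right s (x - δ) s |>.symm]
          exact max_le (by simp; positivity) (by linarith))
        have a2 := hl (max s (x - δ)) x hy1 hy2 h2 (by linarith [le_max_right s (x - δ)])
        linarith
    obtain ⟨n, hn⟩ := exists_nat_ge ((t - s) / δ)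
    exact ind n t hst le_rfl (by rwa [div_le_iff₀ hδ] at hn)
  refine le_of_forall_pos_le_add fun η hη => ?_
  have h1 := key (η / (t - s + 1)) (div_pos hη (by linarith))
  have h2 : (t - s) * (η / (t - s + 1)) ≤ η := by
    rw [← mul_div_assoc, div_le_iff₀ (by linarith)]
    nlinarith
  linarith

theorem le_mul_exp_of_local {f β B : ℝ → ℝ} {a b : ℝ} (hf : ContinuousOn f (Set.Icc a b))
    (hβ : ContinuousOn β (Set.Icc a b)) (hfa : 0 ≤ f a)
    (hB : ∀ x ∈ Set.Icc a b, HasDerivAt B (β x) x)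
    (H : ∀ s t g, a ≤ s → s ≤ t → t ≤ b → (∀ τ ∈ Set.Icc s t, β τ * f τ ≤ g) →
      f t - f s ≤ (t - s) * g) (hab : a ≤ b) :
    f b ≤ f a * Real.exp (B b - B a) := by
  have key : ∀ ε > 0, f b ≤ (f a + ε) * Real.exp (B b - B a + ε * (b - a)) := by
    intro ε hε
    have hd : ∀ x ∈ Set.Icc a b, HasDerivAt
        (fun x => (f a + ε) * Real.exp (B x - B a + ε * (x - a)))
        ((f a + ε) * (Real.exp (B x - B a + ε * (x - a)) * (β x + ε * 1))) x := by
      intro x hx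
      exact ((((hB x hx).sub_const _).add
        (((hasDerivAt_id x).sub_const a).const_mul ε)).exp).const_mul _
    refine image_le_of_liminf_slope_right_lt_deriv_boundary' (a := a) (b := b)
      (f' := fun x => β x * f x) hf ?_ ?_
      (fun x hx => (hd x hx).continuousAt.continuousWithinAt)
      (fun x hx => (hd x ⟨hx.1, hx.2.le⟩).hasDerivWithinAt) ?_ ⟨hab, le_rfl⟩
    · intro x hx r hr
      obtain ⟨r', hr1, hr2⟩ := exists_between hr
      have hc : ContinuousWithinAt (fun x => β x * f x) (Set.Icc a b) x :=
        (hβ.mul hf) x ⟨hx.1, hx.2.le⟩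
      have hev : ∀ᶠ y in nhdsWithin x (Set.Icc a b), β y * f y < r' :=
        hc.eventually (gt_mem_nhds hr1)
      obtain ⟨η, hη, hball⟩ := Metric.mem_nhdsWithin_iff.1 hev
      have hmem : Set.Ioo x (min b (x + η)) ∈ nhdsWithin x (Set.Ioi x) :=
        Ioo_mem_nhdsGT (lt_min hx.2 (by linarith))
      refine Eventually.frequently ?_
      filter_upwards [hmem] with z hz
      have hz1 : z < b := hz.2.trans_le (min_le_left _ _)
      have hz2 : z < x + η := hz.2.trans_le (min_le_right _ _)
      have h1 := H x z r' hx.1 hz.1.le hz1.le (fun τ hτ => by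
        refine le_of_lt (hball ⟨?_, hx.1.trans hτ.1, hτ.2.trans hz1.le⟩)
        rw [Metric.mem_ball, Real.dist_eq, abs_of_nonneg (by linarith [hτ.1])]
        linarith [hτ.2])
      rw [slope_def_field]
      have hpos : 0 < z - x := by linarith [hz.1]
      rw [div_lt_iff₀ hpos]
      nlinarith
    · simp [hε.le]
    · intro x hx hfx
      rw [hfx]
      have : 0 < (f a + ε) * Real.exp (B x - B a + ε * (x - a)) := by positivity
      nlinarith
  have hlim : Tendsto (fun ε : ℝ => (f a + ε) * Real.exp (B b - B a + ε * (b - a)))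
      (nhdsWithin 0 (Set.Ioi 0)) (nhds ((f a + 0) * Real.exp (B b - B a + 0 * (b - a)))) :=
    Tendsto.mono_left (Continuous.tendsto (by fun_prop) 0) nhdsWithin_le_nhds
  have := ge_of_tendsto hlim (by filter_upwards [self_mem_nhdsWithin] with ε hε; exact key ε hε)
  simpa using this

/-- A lower semicontinuous function which is controlled, on short intervals where it is bounded,
by its value at any point of the interval, is bounded. -/
theorem bddAbove_of_local_control {Z : ℝ → ℝ} {a b δ : ℝ} (hδ : 0 < δ)
    (hcl : ∀ m : ℝ, IsClosed {t | t ∈ Set.Icc a b ∧ Z t ≤ m})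
    (hP : ∀ s ∈ Set.Icc a b, ∀ t ∈ Set.Icc a b, |t - s| ≤ δ → BddAbove (Z '' Set.uIcc s t) →
      ∀ x ∈ Set.uIcc s t, ∀ y ∈ Set.uIcc s t, Z y ≤ 4 * Z x + 1) :
    BddAbove (Z '' Set.Icc a b) := by
  set G : Set ℝ := {t | ∃ N ∈ nhdsWithin t (Set.Icc a b), BddAbove (Z '' N)} with hG
  have hcomp : ∀ K : Set ℝ, IsCompact K → K ⊆ Set.Icc a b → K ⊆ G → BddAbove (Z '' K) := by
    intro K hK hKI hKG
    refine hK.induction_on (p := fun s => BddAbove (Z '' s)) (by simp)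
      (fun s t hst ht => ht.mono (Set.image_mono hst))
      (fun s t hs ht => by rw [Set.image_union]; exact hs.union ht) fun x hx => ?_
    obtain ⟨N, hN, hb⟩ := hKG hx
    exact ⟨N, nhdsWithin_mono x hKI hN, hb⟩
  set S : Set ℝ := Set.Icc a b \ G with hS
  have hSc : IsClosed S := by
    rw [← isOpen_compl_iff, isOpen_iff_mem_nhds]
    intro t ht
    by_cases hti : t ∈ Set.Icc a b
    · have htG : t ∈ G := by
        by_contra hn; exact ht ⟨hti, hn⟩
      obtain ⟨N, hN, hb⟩ := htG
      have h2 := eventually_eventually_nhdsWithin.2 hN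
      rw [eventually_nhdsWithin_iff] at h2
      filter_upwards [h2] with y hy hyS
      exact hyS.2 ⟨N, hy hyS.1, hb⟩
    · exact mem_of_superset (isClosed_Icc.isOpen_compl.mem_nhds hti) fun y hy hyS => hy hyS.1
  by_contra hnot
  have hSne : S.Nonempty := by
    by_contra hemp
    rw [Set.not_nonempty_iff_eq_empty] at hemp
    exact hnot (hcomp _ isCompact_Icc subset_rfl (Set.sdiff_eq_empty.1 hemp))
  have : Nonempty S := hSne.to_subtype
  have : CompleteSpace S := hSc.completeSpace_coe
  obtain ⟨n, t0, ht0⟩ := nonempty_interior_of_iUnion_of_closed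
    (X := S) (f := fun n : ℕ => {t : S | Z t ≤ n})
    (fun n => by
      have : {t : S | Z t ≤ n} = Subtype.val ⁻¹' {t | t ∈ Set.Icc a b ∧ Z t ≤ n} := by
        ext t; simp only [Set.mem_ofPred_eq, Set.mem_preimage]
        exact ⟨fun h => ⟨t.2.1, h⟩, fun h => h.2⟩
      rw [this]
      exact (hcl n).preimage continuous_subtype_val)
    (by
      ext t; simp only [Set.mem_iUnion, Set.mem_ofPred_eq, Set.mem_univ, iff_true]
      exact exists_nat_ge _)
  obtain ⟨ε, hε, hball⟩ := Metric.mem_nhds_iff.1 (mem_interior_iff_mem_nhds.1 ht0)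
  have hZn : ∀ t ∈ S, |t - t0| < ε → Z t ≤ n := fun t ht hd => hball (a := ⟨t, ht⟩) hd
  refine t0.2.2 ⟨Set.Icc a b ∩ Metric.ball (t0:ℝ) (min ε δ),
    inter_mem self_mem_nhdsWithin (nhdsWithin_le_nhds (Metric.ball_mem_nhds _ (lt_min hε hδ))),
    4 * n + 1, ?_⟩
  rintro _ ⟨t, ⟨hti, htb⟩, rfl⟩
  rw [Metric.mem_ball, Real.dist_eq] at htb
  have hte : |t - t0| < ε := htb.trans_le (min_le_left _ _)
  have htd : |t - t0| < δ := htb.trans_le (min_le_right _ _)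
  obtain ⟨c, ⟨hc1, hc2⟩, hmin⟩ := (isCompact_uIcc.inter_right hSc).exists_isMinOn
    (s := Set.uIcc (t0:ℝ) t ∩ S) ⟨t0, Set.left_mem_uIcc, t0.2⟩
    (f := fun x => |t - x|) (by fun_prop)
  have hct : |t - c| ≤ |t - t0| := hmin ⟨Set.left_mem_uIcc, t0.2⟩
  have hZc : Z c ≤ n := by
    refine hZn c hc2 (lt_of_le_of_lt ?_ hte)
    exact Set.abs_sub_left_of_mem_uIcc hc1
  have hsubI : ∀ x ∈ Set.Icc a b, ∀ y ∈ Set.Icc a b, Set.uIcc x y ⊆ Set.Icc a b :=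
    fun x hx y hy => Set.ordConnected_Icc.uIcc_subset hx hy
  have hgood : ∀ s ∈ Set.uIcc c t, s ≠ c → Set.uIcc s t ⊆ G := by
    intro s hs hsc y hy
    by_contra hyG
    have hy0 : y ∈ Set.uIcc c t := Set.uIcc_subset_uIcc hs Set.right_mem_uIcc hy
    have hyS : y ∈ S := ⟨hsubI c hc2.1 t hti hy0, hyG⟩
    have hm : |t - c| ≤ |t - y| :=
      hmin ⟨Set.uIcc_subset_uIcc hc1 Set.right_mem_uIcc hy0, hyS⟩
    rcases Set.mem_uIcc.1 hs with h1 | h1 <;> rcases Set.mem_uIcc.1 hy with h2 | h2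
    · rw [abs_of_nonneg (by linarith), abs_of_nonneg (by linarith)] at hm
      exact hsc (by linarith)
    · have : s = t := by linarith
      have : y = t := by linarith
      rw [abs_of_nonneg (by linarith), abs_of_nonneg (by linarith)] at hm
      exact hsc (by linarith)
    · have : s = t := by linarith
      have : y = t := by linarith
      rw [abs_of_nonpos (by linarith), abs_of_nonpos (by linarith)] at hm
      exact hsc (by linarith)
    · rw [abs_of_nonpos (by linarith), abs_of_nonpos (by linarith)] at hm
      exact hsc (by linarith)
  have hbd : BddAbove (Z '' Set.uIcc c t) := by
    refine ⟨max (Z c) (4 * Z t + 1), ?_⟩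
    rintro _ ⟨s, hs, rfl⟩
    by_cases hsc : s = c
    · rw [hsc]; exact le_max_left _ _
    · refine le_max_of_le_right ?_
      have hsI := hsubI c hc2.1 t hti hs
      refine hP s hsI t hti ?_ (hcomp _ isCompact_uIcc (hsubI s hsI t hti) (hgood s hs hsc))
        t Set.right_mem_uIcc s Set.left_mem_uIcc
      exact ((Set.abs_sub_right_of_mem_uIcc hs).trans hct).trans htd.le
  have := hP c hc2.1 t hti (hct.trans htd.le) hbd c Set.left_mem_uIcc t Set.right_mem_uIcc
  linarith

end RealAnalysis

theorem lineDerivOp_sub_schwartz (v : Ell 3) (f g : 𝓢(Ell 3, ℝ)) :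
    ∂_{v} (f - g) = ∂_{v} f - ∂_{v} g :=
  map_sub (lineDerivOpCLM ℝ 𝓢(Ell 3, ℝ) v) f g

section Solution

variable {T : ℝ} {u : ℝ → Ell 3 → Fin 3 → ℝ} {p : ℝ → Ell 3 → ℝ}
  {U : ℝ → Fin 3 → 𝓢(Ell 3, ℝ)}

theorem tendsto_lineDerivOp (h : IsNSSolution T u p)
    (hU : ∀ t ∈ Set.Ico 0 T, ∀ l x, u t x l = U t l x) {τ : ℕ → ℝ} {t : ℝ}
    (hτ : ∀ n, τ n ∈ Set.Ioo 0 T) (ht : t ∈ Set.Ioo 0 T) (hlim : Tendsto τ atTop (nhds t))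
    (i l : Fin 3) (x : Ell 3) :
    Tendsto (fun n => ∂_{eVec 3 i} (U (τ n) l) x) atTop (nhds (∂_{eVec 3 i} (U t l) x)) := by
  set f : ℝ × Ell 3 → ℝ := fun q => u q.1 q.2 l
  have hO : IsOpen (Set.Ioo 0 T ×ˢ (Set.univ : Set (Ell 3))) := isOpen_Ioo.prod isOpen_univ
  have hf : ContDiffOn ℝ 1 f (Set.Ioo 0 T ×ˢ Set.univ) :=
    ((h.1 l).of_le (by simp)).mono (Set.prod_mono Set.Ioo_subset_Ico_self subset_rfl)
  have hd : ContinuousOn (fderiv ℝ f) (Set.Ioo 0 T ×ˢ Set.univ) :=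
    hf.continuousOn_fderiv_of_isOpen hO le_rfl
  have e : ∀ s ∈ Set.Ioo 0 T, ∂_{eVec 3 i} (U s l) x = fderiv ℝ f (s, x) (0, eVec 3 i) := by
    intro s hs
    have h1 : HasFDerivAt f (fderiv ℝ f (s, x)) (s, x) :=
      ((hf.contDiffAt (hO.mem_nhds ⟨hs, trivial⟩)).differentiableAt one_ne_zero).hasFDerivAt
    have h2 : HasFDerivAt (fun y : Ell 3 => ((s, y) : ℝ × Ell 3))
        (ContinuousLinearMap.inr ℝ ℝ (Ell 3)) x := hasFDerivAt_prodMk_right s x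
    have h3 := h1.comp x h2
    have h4 : f ∘ (fun y : Ell 3 => ((s, y) : ℝ × Ell 3)) = U s l := by
      ext y; exact hU s ⟨hs.1.le, hs.2⟩ l y
    rw [h4] at h3
    rw [SchwartzMap.lineDerivOp_apply_eq_fderiv, h3.fderiv]
    rfl
  simp only [e t ht, e _ (hτ _)]
  have hc : ContinuousAt (fun s => fderiv ℝ f (s, x) (0, eVec 3 i)) t := by
    have h1 : ContinuousAt (fderiv ℝ f) (t, x) :=
      hd.continuousAt (hO.mem_nhds ⟨ht, trivial⟩)
    have h2 : ContinuousAt (fun s : ℝ => fderiv ℝ f (s, x)) t :=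
      ContinuousAt.comp (g := fderiv ℝ f) (f := fun s : ℝ => (s, x)) h1 (by fun_prop)
    exact h2.clm_apply continuousAt_const
  exact hc.tendsto.comp hlim

theorem J_two_le_of_tendsto (h : IsNSSolution T u p)
    (hU : ∀ t ∈ Set.Ico 0 T, ∀ l x, u t x l = U t l x) {τ : ℕ → ℝ} {t z : ℝ}
    (hτ : ∀ n, τ n ∈ Set.Ioo 0 T) (ht : t ∈ Set.Ioo 0 T) (hlim : Tendsto τ atTop (nhds t))
    (hz : ∀ n, J 2 (asm (U (τ n))) ≤ z) : J 2 (asm (U t)) ≤ z := by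
  have hK : (0:ℝ) < (2 * Real.pi) ^ 2 := by positivity
  have hz0 : 0 ≤ z := (J_nonneg 2 _).trans (hz 0)
  set F : ℝ → Ell 3 → ℝ := fun s x => ∑ i, ∑ l, (∂_{eVec 3 i} (U s l) x) ^ 2 with hF
  have hF0 : ∀ s x, 0 ≤ F s x := fun s x =>
    Finset.sum_nonneg fun _ _ => Finset.sum_nonneg fun _ _ => sq_nonneg _
  have hFi : ∀ s, Integrable (F s) := fun s =>
    integrable_finsetSum _ fun i _ => integrable_finsetSum _ fun l _ => integrable_sq _
  have hFJ : ∀ s, ∫ x, F s x = (2 * Real.pi) ^ 2 * J 2 (asm (U s)) := by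
    intro s
    rw [← sum_integral_lineDerivOp_sq, integral_finsetSum]
    exact fun i _ => integrable_finsetSum _ fun l _ => integrable_sq _
  have hFl : ∀ s, ∫⁻ x, ENNReal.ofReal (F s x)
      = ENNReal.ofReal ((2 * Real.pi) ^ 2 * J 2 (asm (U s))) :=
    fun s => by
      rw [← hFJ, ofReal_integral_eq_lintegral_ofReal (hFi s) (Eventually.of_forall (hF0 s))]
  have hpt : ∀ x, Tendsto (fun n => ENNReal.ofReal (F (τ n) x)) atTop
      (nhds (ENNReal.ofReal (F t x))) := fun x =>
    ENNReal.tendsto_ofReal (tendsto_finsetSum _ fun i _ => tendsto_finsetSum _ fun l _ =>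
      (tendsto_lineDerivOp h hU hτ ht hlim i l x).pow 2)
  have hfatou := lintegral_liminf_le' (u := atTop) (μ := (volume : Measure (Ell 3)))
    (f := fun n x => ENNReal.ofReal (F (τ n) x))
    (fun n => (hFi (τ n)).aestronglyMeasurable.aemeasurable.ennreal_ofReal)
  have e1 : (fun x => liminf (fun n => ENNReal.ofReal (F (τ n) x)) atTop)
      = fun x => ENNReal.ofReal (F t x) := funext fun x => (hpt x).liminf_eq
  rw [e1, hFl] at hfatou
  have h2 : liminf (fun n => ∫⁻ x, ENNReal.ofReal (F (τ n) x)) atTop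
      ≤ ENNReal.ofReal ((2 * Real.pi) ^ 2 * z) := by
    refine liminf_le_of_le (by isBoundedDefault) fun c hc => ?_
    obtain ⟨n, hn⟩ := hc.exists
    refine hn.trans ?_
    rw [hFl]
    exact ENNReal.ofReal_le_ofReal (mul_le_mul_of_nonneg_left (hz n) hK.le)
  have h3 := (ENNReal.ofReal_le_ofReal_iff (by positivity)).1 (hfatou.trans h2)
  exact le_of_mul_le_mul_left h3 hK

theorem exists_pow_three_eq {X : ℝ} (hX : 0 ≤ X) : ∃ B, 0 ≤ B ∧ B ^ 3 = X :=
  ⟨X ^ (1 / 3 : ℝ), Real.rpow_nonneg hX _, by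
    rw [← Real.rpow_natCast, ← Real.rpow_mul hX]; norm_num⟩

/-- the right-hand side is controlled in `L²` when `J 5 ≤ L` and `J 2 ≤ z` -/
theorem exists_J_rhsS_le_of_bounds : ∃ C > (0:ℝ), ∀ {L z : ℝ} (V : Fin 3 → 𝓢(Ell 3, ℝ)),
    J 5 (asm V) ≤ L → J 2 (asm V) ≤ z →
    J 0 (asm (rhsS V)) ^ 3 ≤ C * ((L ^ 2 + L) * (1 + z) ^ 5) := by
  obtain ⟨C, hC, h⟩ := exists_J_rhsS_le
  refine ⟨C, hC, fun {L z} V hL hz => (h V).trans ?_⟩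
  have J2 := J_nonneg 2 (asm V)
  have J5 := J_nonneg 5 (asm V)
  have hL0 := J5.trans hL
  have hz0 := J2.trans hz
  have h1 : z ≤ (1 + z) ^ 5 := by
    calc z ≤ 1 + z := by linarith
      _ ≤ _ := le_self_pow₀ (by linarith) (by norm_num)
  have h2 : z ^ 5 ≤ (1 + z) ^ 5 := by gcongr; linarith
  calc C * (J 2 (asm V) * J 5 (asm V) ^ 2 + J 2 (asm V) ^ 5 * J 5 (asm V))
      ≤ C * (z * L ^ 2 + z ^ 5 * L) := by gcongr
    _ ≤ C * ((1 + z) ^ 5 * L ^ 2 + (1 + z) ^ 5 * L) := by gcongr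
    _ = _ := by ring

theorem exists_J_sub_pow_le : ∃ C > (0:ℝ), ∀ {T : ℝ} {u : ℝ → Ell 3 → Fin 3 → ℝ}
    {p : ℝ → Ell 3 → ℝ} {U : ℝ → Fin 3 → 𝓢(Ell 3, ℝ)} (_ : IsNSSolution T u p)
    (_ : ∀ t ∈ Set.Ico 0 T, ∀ l x, u t x l = U t l x) {s t L z : ℝ},
    0 < s → s ≤ t → t < T → (∀ τ ∈ Set.Icc s t, J 5 (asm (U τ)) ≤ L) →
    (∀ τ ∈ Set.Icc s t, J 2 (asm (U τ)) ≤ z) →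
    J 2 (asm (U t) - asm (U s)) ^ 5 ≤ C * (L ^ 2 * (L ^ 2 + L)) * (1 + z) ^ 5 * (t - s) ^ 6 ∧
    J 4 (asm (U t) - asm (U s)) ^ 15 ≤ C * (L ^ 12 * (L ^ 2 + L)) * (1 + z) ^ 5 * (t - s) ^ 6 := by
  obtain ⟨C, hC, hR⟩ := exists_J_rhsS_le_of_bounds
  refine ⟨256 ^ 3 * C, by positivity, fun {T u p U} h hU {s t L z} hs hst ht h5 h2 => ?_⟩
  have hsm : s ∈ Set.Icc s t := ⟨le_rfl, hst⟩
  have htm : t ∈ Set.Icc s t := ⟨hst, le_rfl⟩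
  have hL0 : 0 ≤ L := (J_nonneg 5 _).trans (h5 s hsm)
  have hz0 : 0 ≤ z := (J_nonneg 2 _).trans (h2 s hsm)
  set X := C * ((L ^ 2 + L) * (1 + z) ^ 5) with hX
  obtain ⟨B, hB0, hB3⟩ := exists_pow_three_eq (show 0 ≤ X by positivity)
  have hB : ∀ τ ∈ Set.Icc s t, J 0 (asm (rhsS (U τ))) ≤ B := fun τ hτ =>
    le_of_pow_le_pow_left₀ three_ne_zero hB0 (by rw [hB3]; exact hR _ (h5 τ hτ) (h2 τ hτ))
  set v := asm (U t) - asm (U s) with hv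
  have hva : v = asm (U t - U s) := by rw [hv, map_sub]
  have hW : ∀ x, ∑ i, ∂_{eVec 3 i} ((U t - U s) i) x = 0 := by
    intro x
    have h1 := sum_lineDerivOp_eq_zero h hU (t := t) ⟨hs.le.trans hst, ht⟩ x
    have h2 := sum_lineDerivOp_eq_zero h hU (t := s) ⟨hs.le, hst.trans_lt ht⟩ x
    simp only [Pi.sub_apply, lineDerivOp_sub_schwartz, sub_apply, Finset.sum_sub_distrib, h1, h2,
      sub_zero]
  have hone : Function.HasTemperateGrowth (fun _ : Ell 3 => (1:ℝ)) := by fun_prop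
  have key := Pm_sub_le h hU hone hW (g := √(B * J 4 v)) hs hst ht hB (fun τ hτ => by
    have h1 := abs_Pm_le (m := fun _ => (1:ℝ)) (M := 1) continuous_const (by simp)
      (asm (rhsS (U τ))) (asm (U t - U s))
    rw [← hva, one_mul] at h1
    rw [← hva]
    exact (le_abs_self _).trans (h1.trans (Real.sqrt_le_sqrt
      (mul_le_mul_of_nonneg_right (hB τ hτ) (J_nonneg 4 v)))))
  rw [← hva, ← hv, Pm_one_self] at key
  have J2 := J_nonneg 2 v
  have J4 := J_nonneg 4 v
  have J5 := J_nonneg 5 v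
  have J5L : J 5 v ≤ 4 * L := by
    have := J_sub_le 5 (asm (U t)) (asm (U s))
    linarith [h5 s hsm, h5 t htm]
  have h43 := J_four_pow_three_le v
  have hh : 0 ≤ t - s := by linarith
  have hsq : J 2 v ^ 2 ≤ (t - s) ^ 2 * (B * J 4 v) := by
    calc J 2 v ^ 2 ≤ ((t - s) * √(B * J 4 v)) ^ 2 := by gcongr
      _ = _ := by rw [mul_pow, Real.sq_sqrt (by positivity)]
  have c1 : J 2 v ^ 5 ≤ 16 * (L ^ 2 * X) * (t - s) ^ 6 := by
    rcases J2.eq_or_lt with h0 | hpos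
    · rw [← h0]; simp only [ne_eq, OfNat.ofNat_ne_zero, not_false_eq_true, zero_pow]; positivity
    · refine le_of_mul_le_mul_right ?_ hpos
      calc J 2 v ^ 5 * J 2 v = (J 2 v ^ 2) ^ 3 := by ring
        _ ≤ ((t - s) ^ 2 * (B * J 4 v)) ^ 3 := by gcongr
        _ = (t - s) ^ 6 * (B ^ 3 * J 4 v ^ 3) := by ring
        _ ≤ (t - s) ^ 6 * (X * (J 2 v * (4 * L) ^ 2)) := by
            rw [hB3]
            gcongr
            exact h43.trans (by gcongr)
        _ = _ := by ring
  have c2 : J 4 v ^ 5 ≤ 256 * L ^ 4 * B * (t - s) ^ 2 := by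
    rcases J4.eq_or_lt with h0 | hpos
    · rw [← h0]; simp only [ne_eq, OfNat.ofNat_ne_zero, not_false_eq_true, zero_pow]; positivity
    · refine le_of_mul_le_mul_right ?_ hpos
      calc J 4 v ^ 5 * J 4 v = (J 4 v ^ 3) ^ 2 := by ring
        _ ≤ (J 2 v * J 5 v ^ 2) ^ 2 := by gcongr
        _ = J 2 v ^ 2 * J 5 v ^ 4 := by ring
        _ ≤ ((t - s) ^ 2 * (B * J 4 v)) * (4 * L) ^ 4 := by gcongr
        _ = _ := by ring
  refine ⟨c1.trans ?_, ?_⟩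
  · have : 0 ≤ (L ^ 2 * X) * (t - s) ^ 6 := by positivity
    calc 16 * (L ^ 2 * X) * (t - s) ^ 6 ≤ 256 ^ 3 * (L ^ 2 * X) * (t - s) ^ 6 := by
          nlinarith
      _ = _ := by rw [hX]; ring
  · calc J 4 v ^ 15 = (J 4 v ^ 5) ^ 3 := by ring
      _ ≤ (256 * L ^ 4 * B * (t - s) ^ 2) ^ 3 := by gcongr
      _ = 256 ^ 3 * L ^ 12 * B ^ 3 * (t - s) ^ 6 := by ring
      _ = _ := by rw [hB3, hX]; ring

end Solution

theorem exists_le_of_pow_le_mul_pow {X κ : ℝ} {n : ℕ} (hn : n ≠ 0) (hX : 0 ≤ X) (hκ : 0 < κ) :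
    ∃ δ > (0:ℝ), ∀ r, 0 ≤ r → r ≤ δ → ∀ y, y ^ n ≤ X * r ^ 6 → y ≤ κ := by
  refine ⟨min 1 (κ ^ n / (X + 1)), by positivity, fun r hr hrδ y hy => ?_⟩
  have h1 : r ≤ 1 := hrδ.trans (min_le_left _ _)
  have h2 : r * (X + 1) ≤ κ ^ n :=
    (le_div_iff₀ (by positivity)).1 (hrδ.trans (min_le_right _ _))
  have h3 : r ^ 6 ≤ r := pow_le_of_le_one hr h1 (by norm_num)
  refine le_of_pow_le_pow_left₀ hn hκ.le (hy.trans ?_)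
  calc X * r ^ 6 ≤ X * r := by gcongr
    _ ≤ r * (X + 1) := by linarith
    _ ≤ κ ^ n := h2

theorem lineDerivOp_add_schwartz (v : Ell 3) (f g : 𝓢(Ell 3, ℝ)) :
    ∂_{v} (f + g) = ∂_{v} f + ∂_{v} g :=
  map_add (lineDerivOpCLM ℝ 𝓢(Ell 3, ℝ) v) f g

section Solution

variable {T : ℝ} {u : ℝ → Ell 3 → Fin 3 → ℝ} {p : ℝ → Ell 3 → ℝ}
  {U : ℝ → Fin 3 → 𝓢(Ell 3, ℝ)}

theorem exists_J_two_le_of_close (h : IsNSSolution T u p)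
    (hU : ∀ t ∈ Set.Ico 0 T, ∀ l x, u t x l = U t l x) {L : ℝ} (hL : 0 ≤ L) :
    ∃ δ > (0:ℝ), ∀ s ∈ Set.Ioo 0 T, ∀ t ∈ Set.Ioo 0 T, |t - s| ≤ δ →
      (∀ τ ∈ Set.uIcc s t, J 5 (asm (U τ)) ≤ L) →
      BddAbove ((fun τ => J 2 (asm (U τ))) '' Set.uIcc s t) →
      ∀ x ∈ Set.uIcc s t, ∀ y ∈ Set.uIcc s t, J 2 (asm (U y)) ≤ 4 * J 2 (asm (U x)) + 1 := by
  obtain ⟨C, hC, hdiff⟩ := exists_J_sub_pow_le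
  obtain ⟨δ, hδ, H⟩ := exists_le_of_pow_le_mul_pow (X := C * (L ^ 2 * (L ^ 2 + L))) (n := 5)
    (κ := 1 / 8) (by norm_num) (by positivity) (by norm_num)
  refine ⟨δ, hδ, fun s hs t ht hst h5 hb => ?_⟩
  set z := sSup ((fun τ => J 2 (asm (U τ))) '' Set.uIcc s t) with hzdef
  have hz : ∀ τ ∈ Set.uIcc s t, J 2 (asm (U τ)) ≤ z := fun τ hτ =>
    le_csSup hb ⟨τ, hτ, rfl⟩
  have hz0 : 0 ≤ z := (J_nonneg 2 _).trans (hz s Set.left_mem_uIcc)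
  have hord : ∀ x ∈ Set.uIcc s t, ∀ y ∈ Set.uIcc s t, x ≤ y →
      J 2 (asm (U y) - asm (U x)) ≤ (1 + z) / 8 := by
    intro x hx y hy hxy
    have hsub : Set.Icc x y ⊆ Set.uIcc s t := Set.ordConnected_uIcc.out hx hy
    have hx0 : x ∈ Set.Ioo 0 T := (Set.ordConnected_Ioo.uIcc_subset hs ht) hx
    have hy0 : y ∈ Set.Ioo 0 T := (Set.ordConnected_Ioo.uIcc_subset hs ht) hy
    have h1 := (hdiff h hU hx0.1 hxy hy0.2 (fun τ hτ => h5 τ (hsub hτ))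
      (fun τ hτ => hz τ (hsub hτ))).1
    have h2 : y - x ≤ δ := by
      have := Set.abs_sub_le_of_uIcc_subset_uIcc
        (Set.uIcc_subset_uIcc hx hy : Set.uIcc x y ⊆ Set.uIcc s t)
      exact (le_abs_self _).trans (this.trans hst)
    have h3 := H (y - x) (by linarith) h2 (J 2 (asm (U y) - asm (U x)) / (1 + z)) (by
      rw [div_pow, div_le_iff₀ (by positivity)]
      linarith)
    rw [div_le_iff₀ (by positivity)] at h3
    linarith
  have hany : ∀ x ∈ Set.uIcc s t, ∀ y ∈ Set.uIcc s t,
      J 2 (asm (U y) - asm (U x)) ≤ (1 + z) / 8 := by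
    intro x hx y hy
    rcases le_total x y with hxy | hxy
    · exact hord x hx y hy hxy
    · rw [J_sub_comm]; exact hord y hy x hx hxy
  intro x hx y hy
  have hzx : z ≤ 2 * J 2 (asm (U x)) + (1 + z) / 4 := by
    refine csSup_le (Set.nonempty_uIcc.image _) ?_
    rintro _ ⟨w, hw, rfl⟩
    have := J_le_add_sub 2 (asm (U w)) (asm (U x))
    have := hany x hx w hw
    dsimp only
    linarith
  have := hz y hy
  have := J_nonneg 2 (asm (U x))
  linarith

theorem bddAbove_J_two (h : IsNSSolution T u p)
    (hU : ∀ t ∈ Set.Ico 0 T, ∀ l x, u t x l = U t l x) {a b L : ℝ} (ha : 0 < a) (hb : b < T)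
    (h5 : ∀ τ ∈ Set.Icc a b, J 5 (asm (U τ)) ≤ L) :
    BddAbove ((fun τ => J 2 (asm (U τ))) '' Set.Icc a b) := by
  rcases lt_or_ge b a with hab | hab
  · simp [Set.Icc_eq_empty_of_lt hab]
  have hL : 0 ≤ L := (J_nonneg 5 _).trans (h5 a ⟨le_rfl, hab⟩)
  have hin : ∀ x ∈ Set.Icc a b, x ∈ Set.Ioo 0 T := fun x hx => ⟨ha.trans_le hx.1, hx.2.trans_lt hb⟩
  obtain ⟨δ, hδ, H⟩ := exists_J_two_le_of_close h hU hL
  refine bddAbove_of_local_control hδ (fun m => ?_) (fun s hs t ht hst hbd => ?_)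
  · refine IsSeqClosed.isClosed fun τ t hτ hlim => ?_
    have ht : t ∈ Set.Icc a b := isClosed_Icc.mem_of_tendsto hlim
      (Eventually.of_forall fun n => (hτ n).1)
    exact ⟨ht, J_two_le_of_tendsto h hU (fun n => hin _ (hτ n).1) (hin t ht) hlim
      fun n => (hτ n).2⟩
  · exact H s (hin s hs) t (hin t ht) hst
      (fun τ hτ => h5 τ (Set.ordConnected_Icc.uIcc_subset hs ht hτ)) hbd

theorem exists_J_sub_le (h : IsNSSolution T u p)
    (hU : ∀ t ∈ Set.Ico 0 T, ∀ l x, u t x l = U t l x) {a b L z κ : ℝ} (ha : 0 < a) (hb : b < T)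
    (h5 : ∀ τ ∈ Set.Icc a b, J 5 (asm (U τ)) ≤ L)
    (h2 : ∀ τ ∈ Set.Icc a b, J 2 (asm (U τ)) ≤ z) (hκ : 0 < κ) :
    ∃ δ > (0:ℝ), ∀ s ∈ Set.Icc a b, ∀ t ∈ Set.Icc a b, |t - s| ≤ δ →
      J 2 (asm (U t) - asm (U s)) ≤ κ ∧ J 4 (asm (U t) - asm (U s)) ≤ κ := by
  rcases lt_or_ge b a with hab | hab
  · exact ⟨1, one_pos, fun s hs => by simp [Set.Icc_eq_empty_of_lt hab] at hs⟩
  have hL : 0 ≤ L := (J_nonneg 5 _).trans (h5 a ⟨le_rfl, hab⟩)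
  have hz : 0 ≤ z := (J_nonneg 2 _).trans (h2 a ⟨le_rfl, hab⟩)
  obtain ⟨C, hC, hdiff⟩ := exists_J_sub_pow_le
  obtain ⟨δ₂, hδ₂, H₂⟩ := exists_le_of_pow_le_mul_pow (n := 5)
    (X := C * (L ^ 2 * (L ^ 2 + L)) * (1 + z) ^ 5) (by norm_num) (by positivity) hκ
  obtain ⟨δ₄, hδ₄, H₄⟩ := exists_le_of_pow_le_mul_pow (n := 15)
    (X := C * (L ^ 12 * (L ^ 2 + L)) * (1 + z) ^ 5) (by norm_num) (by positivity) hκ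
  have key : ∀ s ∈ Set.Icc a b, ∀ t ∈ Set.Icc a b, s ≤ t → |t - s| ≤ min δ₂ δ₄ →
      J 2 (asm (U t) - asm (U s)) ≤ κ ∧ J 4 (asm (U t) - asm (U s)) ≤ κ := by
    intro s hs t ht hst hd
    have hsub : Set.Icc s t ⊆ Set.Icc a b := Set.Icc_subset_Icc hs.1 ht.2
    have h1 := hdiff h hU (ha.trans_le hs.1) hst (ht.2.trans_lt hb)
      (fun τ hτ => h5 τ (hsub hτ)) (fun τ hτ => h2 τ (hsub hτ))
    have hd' := (le_abs_self _).trans hd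
    exact ⟨H₂ (t - s) (by linarith) (hd'.trans (min_le_left _ _)) _ h1.1,
      H₄ (t - s) (by linarith) (hd'.trans (min_le_right _ _)) _ h1.2⟩
  refine ⟨min δ₂ δ₄, by positivity, fun s hs t ht hd => ?_⟩
  rcases le_total s t with hst | hst
  · exact key s hs t ht hst hd
  · rw [J_sub_comm 2, J_sub_comm 4]
    exact key t ht s hs hst (by rwa [abs_sub_comm])

theorem continuousOn_J {S : Set ℝ} {j : ℕ} {M : ℝ} {f : ℝ → 𝓢(Ell 3, CV)}
    (hM : ∀ τ ∈ S, J (2 * j) (f τ) ≤ M)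
    (H : ∀ κ > 0, ∃ δ > (0:ℝ), ∀ s ∈ S, ∀ t ∈ S, |t - s| ≤ δ → J (2 * j) (f t - f s) ≤ κ) :
    ContinuousOn (fun τ => J (2 * j) (f τ)) S := by
  rw [Metric.continuousOn_iff]
  intro s hs ε hε
  have hM0 : 0 ≤ M := (J_nonneg _ _).trans (hM s hs)
  obtain ⟨δ, hδ, hd⟩ := H (ε ^ 2 / (4 * (4 * M + 1))) (by positivity)
  refine ⟨δ, hδ, fun t ht hts => ?_⟩
  rw [Real.dist_eq] at hts ⊢
  have h1 := hd s hs t ht hts.le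
  have h2 : J (2 * j) (f t + f s) ≤ 4 * M + 1 := by
    have := J_add_le (2 * j) (f t) (f s)
    linarith [hM s hs, hM t ht]
  have h3 := J_sub_sq_le j (f t) (f s)
  have h4 : (J (2 * j) (f t) - J (2 * j) (f s)) ^ 2 ≤ (ε / 2) ^ 2 := by
    refine h3.trans ?_
    calc J (2 * j) (f t - f s) * J (2 * j) (f t + f s)
        ≤ ε ^ 2 / (4 * (4 * M + 1)) * (4 * M + 1) := by
          have := J_nonneg (2 * j) (f t + f s)
          gcongr
      _ = _ := by field_simp; norm_num
  exact (abs_le_of_sq_le_sq h4 (by positivity)).trans_lt (by linarith)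

theorem Pm_self_sub_le (h : IsNSSolution T u p)
    (hU : ∀ t ∈ Set.Ico 0 T, ∀ l x, u t x l = U t l x) {m : Ell 3 → ℝ}
    (hm : m.HasTemperateGrowth) {M : ℝ} (hM : ∀ ξ, |m ξ| ≤ M) {s t L z g : ℝ}
    (hs : 0 < s) (hst : s ≤ t) (ht : t < T)
    (h5 : ∀ τ ∈ Set.Icc s t, J 5 (asm (U τ)) ≤ L)
    (h2 : ∀ τ ∈ Set.Icc s t, J 2 (asm (U τ)) ≤ z)
    (hg : ∀ τ ∈ Set.Icc s t, 2 * Pm m (asm (rhsS (U τ))) (asm (U τ)) ≤ g) :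
    Pm m (asm (U t)) (asm (U t)) - Pm m (asm (U s)) (asm (U s)) ≤ (t - s) * g := by
  have hmc : Continuous m := hm.1.continuous
  have hM0 : 0 ≤ M := (abs_nonneg _).trans (hM 0)
  have hsm : s ∈ Set.Icc s t := ⟨le_rfl, hst⟩
  have hL0 : 0 ≤ L := (J_nonneg 5 _).trans (h5 s hsm)
  have hz0 : 0 ≤ z := (J_nonneg 2 _).trans (h2 s hsm)
  obtain ⟨C, hC, hR⟩ := exists_J_rhsS_le_of_bounds
  obtain ⟨B, hB0, hB3⟩ := exists_pow_three_eq
    (show 0 ≤ C * ((L ^ 2 + L) * (1 + z) ^ 5) by positivity)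
  have hB : ∀ τ ∈ Set.Icc s t, J 0 (asm (rhsS (U τ))) ≤ B := fun τ hτ =>
    le_of_pow_le_pow_left₀ three_ne_zero hB0 (by rw [hB3]; exact hR _ (h5 τ hτ) (h2 τ hτ))
  refine sub_le_of_local (E := fun τ => Pm m (asm (U τ)) (asm (U τ))) hst fun ε hε => ?_
  set κ := ε ^ 2 / (4 * (M ^ 2 * B + 1)) with hκ
  have hκ0 : 0 < κ := by positivity
  have hκε : M * √(B * κ) ≤ ε / 2 := by
    refine le_of_pow_le_pow_left₀ two_ne_zero (by positivity) ?_
    rw [mul_pow, Real.sq_sqrt (by positivity)]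
    calc M ^ 2 * (B * κ) ≤ (M ^ 2 * B + 1) * κ := by nlinarith
      _ = _ := by rw [hκ]; field_simp; norm_num
  obtain ⟨δ, hδ, hd⟩ := exists_J_sub_le h hU hs ht h5 h2 hκ0
  refine ⟨δ, hδ, fun s' t' hs' hst' ht' hlen => ?_⟩
  have hsub : Set.Icc s' t' ⊆ Set.Icc s t := Set.Icc_subset_Icc hs' ht'
  have hs'0 : 0 < s' := hs.trans_le hs'
  have hW : ∀ x, ∑ i, ∂_{eVec 3 i} ((U t' + U s') i) x = 0 := by
    intro x
    have h1 := sum_lineDerivOp_eq_zero h hU (t := t') ⟨hs'0.le.trans hst', ht'.trans_lt ht⟩ x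
    have h2 := sum_lineDerivOp_eq_zero h hU (t := s')
      ⟨hs'0.le, (hst'.trans ht').trans_lt ht⟩ x
    simp only [Pi.add_apply, lineDerivOp_add_schwartz, add_apply, Finset.sum_add_distrib, h1, h2,
      add_zero]
  have herr : ∀ τ ∈ Set.Icc s' t', ∀ r ∈ Set.Icc s' t',
      Pm m (asm (rhsS (U τ))) (asm (U r) - asm (U τ)) ≤ ε / 2 := by
    intro τ hτ r hr
    have h1 := abs_Pm_le hmc hM (asm (rhsS (U τ))) (asm (U r) - asm (U τ))
    have h2 : |r - τ| ≤ δ := by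
      rw [abs_le]; constructor <;> linarith [hτ.1, hτ.2, hr.1, hr.2]
    have h3 := (hd τ (hsub hτ) r (hsub hr) h2).2
    have h4 := J_nonneg 4 (asm (U r) - asm (U τ))
    refine (le_abs_self _).trans (h1.trans (le_trans ?_ hκε))
    exact mul_le_mul_of_nonneg_left
      (Real.sqrt_le_sqrt (mul_le_mul (hB τ (hsub hτ)) h3 h4 hB0)) hM0
  have key := Pm_sub_le h hU hm hW (g := g + ε) hs'0 hst' (ht'.trans_lt ht)
    (fun τ hτ => hB τ (hsub hτ)) (fun τ hτ => by
      have e : asm (U t' + U s') = asm (U τ) + (asm (U τ) +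
          ((asm (U t') - asm (U τ)) + (asm (U s') - asm (U τ)))) := by
        rw [map_add]; abel
      rw [e, Pm_add_right hmc hM, Pm_add_right hmc hM, Pm_add_right hmc hM]
      have h1 := herr τ hτ t' ⟨hst', le_rfl⟩
      have h2 := herr τ hτ s' ⟨le_rfl, hst'⟩
      have h3 := hg τ (hsub hτ)
      linarith)
  rwa [map_add, Pm_sub_add hmc hM] at key

end Solution

/-- A bounded smooth truncation of the weight `1 + ‖ξ‖ ^ 2`. -/
def truncWeight (n : ℕ) (ξ : Ell 3) : ℝ :=
  1 + ‖ξ‖ ^ 2 * (⟨n + 1, n + 2, by positivity, by linarith⟩ : ContDiffBump (0 : Ell 3)) ξ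

theorem truncWeight_hasTemperateGrowth (n : ℕ) : (truncWeight n).HasTemperateGrowth := by
  set χ : ContDiffBump (0 : Ell 3) := ⟨n + 1, n + 2, by positivity, by linarith⟩
  have h1 : Function.HasTemperateGrowth (χ : Ell 3 → ℝ) :=
    χ.hasCompactSupport.hasTemperateGrowth χ.contDiff
  have h2 : Function.HasTemperateGrowth (fun ξ : Ell 3 => ‖ξ‖ ^ 2) := by fun_prop
  have : truncWeight n = fun ξ => 1 + ‖ξ‖ ^ 2 * χ ξ := rfl
  rw [this]
  fun_prop

theorem one_le_truncWeight (n : ℕ) (ξ : Ell 3) : 1 ≤ truncWeight n ξ :=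
  le_add_of_nonneg_right (mul_nonneg (by positivity) (ContDiffBump.nonneg _))

theorem truncWeight_le (n : ℕ) (ξ : Ell 3) : truncWeight n ξ ≤ 1 + ‖ξ‖ ^ 2 :=
  add_le_add_right (mul_le_of_le_one_right (by positivity) (ContDiffBump.le_one _)) _

theorem abs_truncWeight_le (n : ℕ) (ξ : Ell 3) : |truncWeight n ξ| ≤ 1 + (n + 2) ^ 2 := by
  rw [abs_of_nonneg (zero_le_one.trans (one_le_truncWeight n ξ))]
  rcases le_total ‖ξ‖ (n + 2) with h | h
  · exact (truncWeight_le n ξ).trans (by gcongr)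
  · have : truncWeight n ξ = 1 := by
      rw [truncWeight, ContDiffBump.zero_of_le_dist _ (by simpa using h)]; simp
    rw [this]
    nlinarith [sq_nonneg ((n:ℝ) + 2)]

theorem truncWeight_eq {n : ℕ} {ξ : Ell 3} (h : ‖ξ‖ ≤ n) : truncWeight n ξ = 1 + ‖ξ‖ ^ 2 := by
  rw [truncWeight, ContDiffBump.one_of_mem_closedBall _ (by simpa using by linarith), mul_one]

theorem tendsto_Pm_truncWeight (a : 𝓢(Ell 3, CV)) :
    Tendsto (fun n => Pm (truncWeight n) a a) atTop (nhds (J 2 a + J 4 a)) := by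
  have i2 : Integrable (fun ξ : Ell 3 => ‖ξ‖ ^ 2 * ‖𝓕 a ξ‖ ^ 2) :=
    integrable_pow_mul_norm_sq 2 (𝓕 a)
  have i4 : Integrable (fun ξ : Ell 3 => ‖ξ‖ ^ 4 * ‖𝓕 a ξ‖ ^ 2) :=
    integrable_pow_mul_norm_sq 4 (𝓕 a)
  have e : J 2 a + J 4 a = ∫ ξ, (1 + ‖ξ‖ ^ 2) * ‖ξ‖ ^ 2 * ‖𝓕 a ξ‖ ^ 2 := by
    rw [J, J, ← integral_add i2 i4]
    exact integral_congr_ae (Eventually.of_forall fun ξ => by dsimp only; ring)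
  have ib : Integrable (fun ξ : Ell 3 => (1 + ‖ξ‖ ^ 2) * ‖ξ‖ ^ 2 * ‖𝓕 a ξ‖ ^ 2) :=
    (i2.add i4).congr (Eventually.of_forall fun ξ => by simp only [Pi.add_apply]; ring)
  simp only [Pm_self, e]
  refine tendsto_integral_of_dominated_convergence _ (fun n => ?_) ib (fun n => ?_) ?_
  · have : Continuous (truncWeight n) := (truncWeight_hasTemperateGrowth n).1.continuous
    have := (𝓕 a).continuous
    exact Continuous.aestronglyMeasurable (by fun_prop)
  · refine Eventually.of_forall fun ξ => ?_
    have h0 := one_le_truncWeight n ξ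
    rw [Real.norm_of_nonneg (by positivity)]
    gcongr
    exact truncWeight_le n ξ
  · refine Eventually.of_forall fun ξ => tendsto_const_nhds.congr' ?_
    obtain ⟨N, hN⟩ := exists_nat_ge ‖ξ‖
    filter_upwards [eventually_ge_atTop N] with n hn
    rw [truncWeight_eq (hN.trans (by exact_mod_cast hn))]

/-- Energy inequality at the level of the velocity gradient. -/
theorem exists_J_two_sub_le : ∃ C > (0:ℝ), ∀ {T : ℝ} {u : ℝ → Ell 3 → Fin 3 → ℝ}
    {p : ℝ → Ell 3 → ℝ} {U : ℝ → Fin 3 → 𝓢(Ell 3, ℝ)} (_ : IsNSSolution T u p)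
    (_ : ∀ t ∈ Set.Ico 0 T, ∀ l x, u t x l = U t l x) {s t L g : ℝ},
    0 < s → s ≤ t → t < T → (∀ τ ∈ Set.Icc s t, J 5 (asm (U τ)) ≤ L) →
    (∀ τ ∈ Set.Icc s t, C * J 2 (asm (U τ)) * √(J 5 (asm (U τ))) ≤ g) →
    J 2 (asm (U t)) - J 2 (asm (U s)) ≤ (t - s) * g := by
  obtain ⟨C, hC, hP⟩ := exists_Pm_one_rhsS_le
  refine ⟨C, hC, fun {T u p U} h hU {s t L g} hs hst ht h5 hg => ?_⟩
  obtain ⟨z, hz⟩ := bddAbove_J_two h hU hs ht h5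
  have := Pm_self_sub_le h hU (m := fun _ => 1) (M := 1) (by fun_prop) (by simp) hs hst ht h5
    (fun τ hτ => hz ⟨τ, hτ, rfl⟩) (fun τ hτ => (hP (U τ)).trans (hg τ hτ))
  rwa [Pm_one_self, Pm_one_self] at this

/-- Energy inequality at the level of one and two derivatives of the velocity. -/
theorem exists_J_two_add_J_four_sub_le : ∃ C > (0:ℝ), ∀ {T : ℝ} {u : ℝ → Ell 3 → Fin 3 → ℝ}
    {p : ℝ → Ell 3 → ℝ} {U : ℝ → Fin 3 → 𝓢(Ell 3, ℝ)} (_ : IsNSSolution T u p)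
    (_ : ∀ t ∈ Set.Ico 0 T, ∀ l x, u t x l = U t l x) {s t L g : ℝ},
    0 < s → s ≤ t → t < T → (∀ τ ∈ Set.Icc s t, J 5 (asm (U τ)) ≤ L) →
    (∀ τ ∈ Set.Icc s t, C * √(J 2 (asm (U τ)) * J 4 (asm (U τ)))
      * (J 2 (asm (U τ)) + J 4 (asm (U τ))) ≤ g) →
    (J 2 (asm (U t)) + J 4 (asm (U t))) - (J 2 (asm (U s)) + J 4 (asm (U s))) ≤ (t - s) * g := by
  obtain ⟨C, hC, hP⟩ := exists_Pm_rhsS_le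
  refine ⟨C, hC, fun {T u p U} h hU {s t L g} hs hst ht h5 hg => ?_⟩
  obtain ⟨z, hz⟩ := bddAbove_J_two h hU hs ht h5
  refine le_of_tendsto ((tendsto_Pm_truncWeight (asm (U t))).sub
    (tendsto_Pm_truncWeight (asm (U s)))) (Eventually.of_forall fun n => ?_)
  have hm := truncWeight_hasTemperateGrowth n
  exact Pm_self_sub_le h hU hm (abs_truncWeight_le n) hs hst ht h5
    (fun τ hτ => hz ⟨τ, hτ, rfl⟩) (fun τ hτ => (hP _ hm.1.continuous _ (abs_truncWeight_le n)
      (fun ξ => zero_le_one.trans (one_le_truncWeight n ξ)) (truncWeight_le n) (U τ)).trans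
        (hg τ hτ))

section Solution

variable {T : ℝ} {u : ℝ → Ell 3 → Fin 3 → ℝ} {p : ℝ → Ell 3 → ℝ}
  {U : ℝ → Fin 3 → 𝓢(Ell 3, ℝ)}

theorem continuousOn_J_two_and_J_four (h : IsNSSolution T u p)
    (hU : ∀ t ∈ Set.Ico 0 T, ∀ l x, u t x l = U t l x) {a b L : ℝ} (ha : 0 < a) (hb : b < T)
    (h5 : ∀ τ ∈ Set.Icc a b, J 5 (asm (U τ)) ≤ L) :
    ContinuousOn (fun τ => J 2 (asm (U τ))) (Set.Icc a b) ∧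
    ContinuousOn (fun τ => J 4 (asm (U τ))) (Set.Icc a b) := by
  obtain ⟨z, hz⟩ := bddAbove_J_two h hU ha hb h5
  have h2 : ∀ τ ∈ Set.Icc a b, J 2 (asm (U τ)) ≤ z := fun τ hτ => hz ⟨τ, hτ, rfl⟩
  have h4 : ∀ τ ∈ Set.Icc a b, J 4 (asm (U τ)) ≤ 1 + z * L ^ 2 := by
    intro τ hτ
    have J2 := J_nonneg 2 (asm (U τ))
    have J5 := J_nonneg 5 (asm (U τ))
    have hz0 := J2.trans (h2 τ hτ)
    refine le_of_pow_le_pow_left₀ three_ne_zero (by positivity) ?_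
    calc J 4 (asm (U τ)) ^ 3 ≤ J 2 (asm (U τ)) * J 5 (asm (U τ)) ^ 2 := J_four_pow_three_le _
      _ ≤ z * L ^ 2 := by gcongr <;> simp_all
      _ ≤ 1 + z * L ^ 2 := by linarith
      _ ≤ (1 + z * L ^ 2) ^ 3 :=
        le_self_pow₀ (le_add_of_nonneg_right (by positivity)) three_ne_zero
  constructor
  · refine continuousOn_J (j := 1) h2 fun κ hκ => ?_
    obtain ⟨δ, hδ, H⟩ := exists_J_sub_le h hU ha hb h5 h2 hκ
    exact ⟨δ, hδ, fun s hs t ht hst => (H s hs t ht hst).1⟩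
  · refine continuousOn_J (j := 2) h4 fun κ hκ => ?_
    obtain ⟨δ, hδ, H⟩ := exists_J_sub_le h hU ha hb h5 h2 hκ
    exact ⟨δ, hδ, fun s hs t ht hst => (H s hs t ht hst).2⟩

end Solution

theorem Hnorm_eq_sqrt_J {k : ℕ} {s : ℝ} (hs : 2 * s = k) (V : Fin 3 → 𝓢(Ell 3, ℝ)) :
    Hnorm s (fun l x => V l x) = √(J k (asm V)) := by
  have i : ∀ l, Integrable (fun ξ : Ell 3 => ‖ξ‖ ^ k * ‖𝓕 (cf (V l)) ξ‖ ^ 2) := by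
    intro l
    refine (integrable_pow_mul_norm_sq k (𝓕 (asm V))).mono' ?_ (Eventually.of_forall fun ξ => ?_)
    · have : Continuous (fun ξ => 𝓕 (cf (V l)) ξ) := by
        have h1 : (fun ξ => 𝓕 (cf (V l)) ξ) = fun ξ => 𝓕 (asm V) ξ l :=
          funext fun ξ => (fourier_asm_apply V ξ l).symm
        rw [h1]
        have := (𝓕 (asm V)).continuous
        fun_prop
      exact Continuous.aestronglyMeasurable (by fun_prop)
    · rw [Real.norm_of_nonneg (by positivity), ← fourier_asm_apply V ξ l]
      gcongr
      exact PiLp.norm_apply_le (𝓕 (asm V) ξ) l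
  unfold Hnorm HsqC J
  congr 1
  simp only [hs, Real.rpow_natCast]
  rw [← integral_finsetSum _ fun l _ => i l]
  refine integral_congr_ae (Eventually.of_forall fun ξ => ?_)
  simp only [EuclideanSpace.norm_sq_eq, fourier_asm_apply, Finset.mul_sum]

section Solution

variable {T : ℝ} {u : ℝ → Ell 3 → Fin 3 → ℝ} {p : ℝ → Ell 3 → ℝ}
  {U : ℝ → Fin 3 → 𝓢(Ell 3, ℝ)}

theorem J_five_le_of_le {a b c : ℝ} (hb : b < T)
    (h5 : ∀ τ ∈ Set.Ico a T, (T - τ) * √(J 5 (asm (U τ))) ≤ c) :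
    ∀ τ ∈ Set.Icc a b, J 5 (asm (U τ)) ≤ (c / (T - b)) ^ 2 := by
  intro τ hτ
  have h1 := h5 τ ⟨hτ.1, hτ.2.trans_lt hb⟩
  have h2 : 0 < T - b := by linarith
  rw [← Real.sq_sqrt (J_nonneg 5 (asm (U τ)))]
  gcongr
  rw [le_div_iff₀ h2, mul_comm]
  refine le_trans ?_ h1
  gcongr
  exact hτ.2

/-- If `‖u(t)‖_{Ḣ^{5/2}}` is at most a small multiple of `(T - t)⁻¹`, the enstrophy grows at most
like `(T - t) ^ (-1/4)`. -/
theorem exists_J_two_growth : ∃ c > (0:ℝ), ∀ {T : ℝ} {u : ℝ → Ell 3 → Fin 3 → ℝ}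
    {p : ℝ → Ell 3 → ℝ} {U : ℝ → Fin 3 → 𝓢(Ell 3, ℝ)} (_ : IsNSSolution T u p)
    (_ : ∀ t ∈ Set.Ico 0 T, ∀ l x, u t x l = U t l x) {a : ℝ} (_ : 0 < a)
    (_ : ∀ τ ∈ Set.Ico a T, (T - τ) * √(J 5 (asm (U τ))) ≤ c),
    ∀ b ∈ Set.Ico a T, J 2 (asm (U b)) ^ 4 * (T - b) ≤ J 2 (asm (U a)) ^ 4 * (T - a) := by
  obtain ⟨C, hC, hE⟩ := exists_J_two_sub_le
  refine ⟨1 / (4 * C), by positivity, fun {T u p U} h hU {a} ha h5 b hb => ?_⟩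
  have hbT : 0 < T - b := by linarith [hb.2]
  have haT : 0 < T - a := by linarith [hb.1]
  have hL := J_five_le_of_le hb.2 h5
  have hpos : ∀ x ∈ Set.Icc a b, 0 < T - x := fun x hx => by linarith [hx.2]
  have key := le_mul_exp_of_local (f := fun τ => J 2 (asm (U τ))) (β := fun τ => 1 / (4 * (T - τ)))
    (B := fun τ => -(1 / 4) * Real.log (T - τ)) (a := a) (b := b)
    (continuousOn_J_two_and_J_four h hU ha hb.2 hL).1
    (continuousOn_const.div (by fun_prop) fun x hx => by have := hpos x hx; positivity)
    (J_nonneg 2 _)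
    (fun x hx => by
      have hx0 := hpos x hx
      have := (((hasDerivAt_id x).const_sub T).log hx0.ne').const_mul (-(1 / 4))
      refine this.congr_deriv ?_
      simp only [id]
      field_simp)
    (fun s t g has hst htb hg => by
      have hsub : Set.Icc s t ⊆ Set.Icc a b := Set.Icc_subset_Icc has htb
      refine hE h hU (ha.trans_le has) hst (htb.trans_lt hb.2) (fun τ hτ => hL τ (hsub hτ))
        fun τ hτ => le_trans ?_ (hg τ hτ)
      have hτ0 := hpos τ (hsub hτ)
      have h1 : √(J 5 (asm (U τ))) ≤ 1 / (4 * C) / (T - τ) := by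
        rw [le_div_iff₀ hτ0, mul_comm]
        exact h5 τ ⟨has.trans hτ.1, (hτ.2.trans htb).trans_lt hb.2⟩
      have := J_nonneg 2 (asm (U τ))
      calc C * J 2 (asm (U τ)) * √(J 5 (asm (U τ)))
          ≤ C * J 2 (asm (U τ)) * (1 / (4 * C) / (T - τ)) := by gcongr
        _ = _ := by field_simp)
    hb.1
  have hexp : Real.exp (-(1 / 4) * Real.log (T - b) - -(1 / 4) * Real.log (T - a)) ^ 4
      = (T - a) / (T - b) := by
    rw [← Real.exp_nat_mul, ← Real.exp_log (div_pos haT hbT), Real.log_div haT.ne' hbT.ne']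
    congr 1
    push_cast
    ring
  have J2 := J_nonneg 2 (asm (U b))
  calc J 2 (asm (U b)) ^ 4 * (T - b)
      ≤ (J 2 (asm (U a)) * Real.exp (-(1 / 4) * Real.log (T - b)
          - -(1 / 4) * Real.log (T - a))) ^ 4 * (T - b) := by gcongr
    _ = _ := by rw [mul_pow, hexp]; field_simp

/-- If `‖u(t)‖_{Ḣ^{5/2}}` is at most a small multiple of `(T - t)⁻¹`, then `u` stays bounded in
`Ḣ¹ ∩ Ḣ²` up to time `T`. -/
theorem exists_J_two_add_J_four_bound : ∃ c > (0:ℝ), ∀ {T : ℝ} {u : ℝ → Ell 3 → Fin 3 → ℝ}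
    {p : ℝ → Ell 3 → ℝ} {U : ℝ → Fin 3 → 𝓢(Ell 3, ℝ)} (_ : IsNSSolution T u p)
    (_ : ∀ t ∈ Set.Ico 0 T, ∀ l x, u t x l = U t l x) {a : ℝ} (_ : 0 < a)
    (_ : ∀ τ ∈ Set.Ico a T, (T - τ) * √(J 5 (asm (U τ))) ≤ c),
    ∃ R, ∀ b ∈ Set.Ico a T, J 2 (asm (U b)) + J 4 (asm (U b)) ≤ R := by
  obtain ⟨c, hc, hZ⟩ := exists_J_two_growth
  obtain ⟨C, hC, hE⟩ := exists_J_two_add_J_four_sub_le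
  refine ⟨c, hc, fun {T u p U} h hU {a} ha h5 => ?_⟩
  rcases lt_or_ge a T with haT | haT
  swap
  · exact ⟨0, fun b hb => absurd (hb.1.trans_lt hb.2) haT.not_gt⟩
  have haT0 : 0 < T - a := by linarith
  set X := J 2 (asm (U a)) ^ 4 * (T - a) * c ^ 4 with hX
  have hX0 : 0 ≤ X := by have := J_nonneg 2 (asm (U a)); positivity
  set K := X ^ (1 / 6 : ℝ) with hK
  have hK0 : 0 ≤ K := Real.rpow_nonneg hX0 _
  have hK6 : K ^ 6 = X := by rw [hK, ← Real.rpow_natCast, ← Real.rpow_mul hX0]; norm_num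
  have hsqrt : ∀ τ ∈ Set.Ico a T,
      √(J 2 (asm (U τ)) * J 4 (asm (U τ))) ≤ K * (T - τ) ^ (-(5 / 6) : ℝ) := by
    intro τ hτ
    have hτ0 : 0 < T - τ := by linarith [hτ.2]
    have hr : ((T - τ) ^ (-(5 / 6) : ℝ)) ^ 6 * (T - τ) ^ 5 = 1 := by
      rw [← Real.rpow_natCast, ← Real.rpow_mul hτ0.le, ← Real.rpow_natCast (T - τ) 5,
        ← Real.rpow_add hτ0]
      norm_num
    refine le_of_pow_le_pow_left₀ (n := 6) (by norm_num) (by positivity) ?_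
    refine le_of_mul_le_mul_right ?_ (pow_pos hτ0 5)
    have J5 := J_nonneg 5 (asm (U τ))
    have h1 := sqrt_pow_three_le (asm (U τ))
    have h2 := hZ h hU ha h5 τ hτ
    have h3 : (T - τ) ^ 4 * J 5 (asm (U τ)) ^ 2 ≤ c ^ 4 := by
      calc (T - τ) ^ 4 * J 5 (asm (U τ)) ^ 2 = ((T - τ) * √(J 5 (asm (U τ)))) ^ 4 := by
            rw [mul_pow, show √(J 5 (asm (U τ))) ^ 4 = (√(J 5 (asm (U τ))) ^ 2) ^ 2 by ring,
              Real.sq_sqrt J5]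
        _ ≤ c ^ 4 := by gcongr; exact h5 τ hτ
    have J2 := J_nonneg 2 (asm (U a))
    calc √(J 2 (asm (U τ)) * J 4 (asm (U τ))) ^ 6 * (T - τ) ^ 5
        = (√(J 2 (asm (U τ)) * J 4 (asm (U τ))) ^ 3) ^ 2 * (T - τ) ^ 5 := by ring
      _ ≤ (J 2 (asm (U τ)) ^ 2 * J 5 (asm (U τ))) ^ 2 * (T - τ) ^ 5 := by gcongr
      _ = (J 2 (asm (U τ)) ^ 4 * (T - τ)) * ((T - τ) ^ 4 * J 5 (asm (U τ)) ^ 2) := by ring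
      _ ≤ (J 2 (asm (U a)) ^ 4 * (T - a)) * c ^ 4 := by gcongr
      _ = X * (((T - τ) ^ (-(5 / 6) : ℝ)) ^ 6 * (T - τ) ^ 5) := by rw [hr, mul_one]
      _ = _ := by rw [mul_pow, hK6]; ring
  refine ⟨(J 2 (asm (U a)) + J 4 (asm (U a))) * Real.exp (6 * C * K * (T - a) ^ (1 / 6 : ℝ)),
    fun b hb => ?_⟩
  have hbT : 0 < T - b := by linarith [hb.2]
  have hL := J_five_le_of_le hb.2 h5
  have hpos : ∀ x ∈ Set.Icc a b, 0 < T - x := fun x hx => by linarith [hx.2]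
  have hcont := continuousOn_J_two_and_J_four h hU ha hb.2 hL
  have S0 : ∀ τ, 0 ≤ J 2 (asm (U τ)) + J 4 (asm (U τ)) := fun τ =>
    add_nonneg (J_nonneg _ _) (J_nonneg _ _)
  have key := le_mul_exp_of_local (f := fun τ => J 2 (asm (U τ)) + J 4 (asm (U τ)))
    (β := fun τ => C * (K * (T - τ) ^ (-(5 / 6) : ℝ)))
    (B := fun τ => -(6 * C * K) * (T - τ) ^ (1 / 6 : ℝ)) (a := a) (b := b)
    (hcont.1.add hcont.2)
    (continuousOn_const.mul (continuousOn_const.mul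
      (ContinuousOn.rpow_const (by fun_prop) fun x hx => Or.inl (hpos x hx).ne')))
    (S0 a)
    (fun x hx => by
      have hx0 := hpos x hx
      have := (((hasDerivAt_id x).const_sub T).rpow_const (p := 1 / 6)
        (Or.inl hx0.ne')).const_mul (-(6 * C * K))
      refine this.congr_deriv ?_
      simp only [id]
      norm_num
      ring)
    (fun s t g has hst htb hg => by
      have hsub : Set.Icc s t ⊆ Set.Icc a b := Set.Icc_subset_Icc has htb
      refine hE h hU (ha.trans_le has) hst (htb.trans_lt hb.2) (fun τ hτ => hL τ (hsub hτ))
        fun τ hτ => le_trans ?_ (hg τ hτ)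
      have := S0 τ
      have := hsqrt τ ⟨has.trans hτ.1, (hτ.2.trans htb).trans_lt hb.2⟩
      gcongr)
    hb.1
  refine key.trans (mul_le_mul_of_nonneg_left (Real.exp_le_exp.2 ?_) (S0 a))
  have : 0 ≤ 6 * C * K * (T - b) ^ (1 / 6 : ℝ) := by positivity
  linarith

end Solution

/-- **Weak blowup estimate in Ḣ^{5/2}.** There is a universal constant `c > 0`
such that any smooth (Schwartz-in-space) solution of the 3D Navier–Stokes
equations on `[0,T)` whose `Ḣ^{3/2}` norm blows up as `t → T⁻` satisfies
`limsup_{t→T⁻} (T−t)·‖u(t)‖_{Ḣ^{5/2}} ≥ c`. -/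
theorem weak_blowup_H52 :
    ∃ c > (0 : ℝ), ∀ (T : ℝ), 0 < T →
      ∀ (u : ℝ → Ell 3 → Fin 3 → ℝ) (p : ℝ → Ell 3 → ℝ),
        IsNSSolution T u p →
        Tendsto (fun t => Hnorm (3 / 2) (fun l x => u t x l))
          (nhdsWithin T (Set.Iio T)) atTop →
        (c : EReal) ≤ Filter.limsup
          (fun t => (((T - t) * Hnorm (5 / 2) (fun l x => u t x l) : ℝ) : EReal))
          (nhdsWithin T (Set.Iio T)) := by
  obtain ⟨c, hc, hbound⟩ := exists_J_two_add_J_four_bound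
  refine ⟨c, hc, fun T hT u p h hblow => ?_⟩
  by_contra! hlim
  have hex : ∀ t, ∃ V : Fin 3 → 𝓢(Ell 3, ℝ), t ∈ Set.Ico 0 T → ∀ l x, u t x l = V l x := by
    intro t
    by_cases ht : t ∈ Set.Ico 0 T
    · choose V hV using h.2.2.1 t ht
      exact ⟨V, fun _ => hV⟩
    · exact ⟨0, fun h' => absurd h' ht⟩
  choose U hU' using hex
  have hU : ∀ t ∈ Set.Ico 0 T, ∀ l x, u t x l = U t l x := fun t ht => hU' t ht
  have e3 : ∀ t ∈ Set.Ico 0 T, Hnorm (3/2) (fun l x => u t x l) = √(J 3 (asm (U t))) := by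
    intro t ht
    simp only [hU t ht]
    exact Hnorm_eq_sqrt_J (by norm_num) (U t)
  have e5 : ∀ t ∈ Set.Ico 0 T, Hnorm (5/2) (fun l x => u t x l) = √(J 5 (asm (U t))) := by
    intro t ht
    simp only [hU t ht]
    exact Hnorm_eq_sqrt_J (by norm_num) (U t)
  have hev := eventually_lt_of_limsup_lt hlim
  obtain ⟨l, hl, hlT⟩ := mem_nhdsLT_iff_exists_Ioo_subset.1 hev
  have hl' : l < T := hl
  set a := max ((l + T) / 2) (T / 2) with ha
  have haT : a < T := max_lt (by linarith) (by linarith)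
  have ha0 : 0 < a := lt_max_of_lt_right (by linarith)
  have hla : l < a := lt_max_of_lt_left (by linarith)
  obtain ⟨R, hR⟩ := hbound h hU ha0 fun τ hτ => by
    have h1 := hlT (⟨hla.trans_le hτ.1, hτ.2⟩ : τ ∈ Set.Ioo l T)
    have h2 := EReal.coe_lt_coe_iff.1 (Set.mem_ofPred_eq ▸ h1)
    rw [e5 τ ⟨ha0.le.trans hτ.1, hτ.2⟩] at h2
    exact h2.le
  have hIoo : Set.Ioo a T ∈ nhdsWithin T (Set.Iio T) := Ioo_mem_nhdsLT haT
  obtain ⟨t, ht1, ht2⟩ := ((hblow.eventually_gt_atTop (√R)).and hIoo).exists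
  rw [e3 t ⟨ha0.le.trans ht2.1.le, ht2.2⟩] at ht1
  have hRt := hR t ⟨ht2.1.le, ht2.2⟩
  have J2 := J_nonneg 2 (asm (U t))
  have J4 := J_nonneg 4 (asm (U t))
  refine ht1.not_ge (Real.sqrt_le_sqrt ?_)
  refine le_of_pow_le_pow_left₀ two_ne_zero (by linarith) ?_
  calc J 3 (asm (U t)) ^ 2 ≤ J 2 (asm (U t)) * J 4 (asm (U t)) := J_interp 2 _
    _ ≤ R ^ 2 := by nlinarith

end
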